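/- arXiv:2509.08517 — 8 statements merged into one kernel-verified Lean document; each statement's English description precedes it below -/
import Mathlib

section
/- Let P ∈ ℂ[X] be a non-constant polynomial and let a ∈ ℂ with a ≠ 0. Then P and its derivative P' do not share the value a in ℂ; that is, it is not the case that for every z ∈ ℂ one has P(z) = a ⇔ P'(z) = a. -/
open Polynomial

/-- A non-constant polynomial cannot share a finite non-zero value with its derivative. -/
theorem polynomial_cannot_share_nonzero_value
    (P : ℂ[X]) (hP : 1 ≤ P.natDegree) (a : ℂ) (ha : a ≠ 0) :
    ¬ (∀ z : ℂ, P.eval z = a ↔ (derivative P).eval z = a) := by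
  intro h
  have hQdeg : (P - C a).natDegree = P.natDegree := natDegree_sub_C
  have hQ : P - C a ≠ 0 := by
    intro h0
    rw [h0, natDegree_zero] at hQdeg
    omega
  have hR : derivative P - C a ≠ 0 := by
    intro h0
    refine hQ (Polynomial.funext fun z => ?_)
    have hz : P.eval z = a := (h z).2 (by rw [sub_eq_zero.1 h0, eval_C])
    simp [hz]
  -- A multiple root of `P - a` would be a zero of `P'`, which takes the value `a ≠ 0` there.
  have hnodup : (P - C a).roots.Nodup := by
    rw [Multiset.nodup_iff_count_le_one]
    intro z
    rw [count_roots]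
    by_contra! hz
    obtain ⟨h1, h2⟩ := (one_lt_rootMultiplicity_iff_isRoot hQ).1 hz
    have h1' : P.eval z = a := by simpa [sub_eq_zero] using h1
    have h2' : (derivative P).eval z = 0 := by simpa using h2
    exact ha (((h z).1 h1').symm.trans h2')
  have hle : (P - C a).roots ≤ (derivative P - C a).roots := by
    rw [Multiset.le_iff_subset hnodup]
    intro z hz
    have hz' : P.eval z = a := by simpa [sub_eq_zero] using isRoot_of_mem_roots hz
    rw [mem_roots hR]
    simp [(h z).1 hz']
  have hcard := (Multiset.card_le_card hle).trans (card_roots' _)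
  rw [← (IsAlgClosed.splits (P - C a)).natDegree_eq_card_roots, hQdeg, natDegree_sub_C] at hcard
  exact (natDegree_derivative_lt (by omega)).not_ge hcard
end

section
/- Let P ∈ ℂ[X] be a non-constant polynomial and let a, b ∈ ℂ with a ≠ b. Then it is not the case that both (for every z ∈ ℂ, P(z) = a ⇔ P'(z) = a) and (for every z ∈ ℂ, P(z) = b ⇔ P'(z) = b); i.e., a non-constant polynomial cannot share two distinct finite values with its derivative. -/
open Polynomial

/-- A non-constant polynomial cannot share a nonzero value with its derivative: all the preimages
of that value would be simple, which is too many for the derivative. -/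
theorem not_forall_eval_eq_iff_eval_derivative_eq
    (P : ℂ[X]) (hP : 1 ≤ P.natDegree) {a : ℂ} (ha : a ≠ 0) :
    ¬ ∀ z : ℂ, P.eval z = a ↔ (derivative P).eval z = a := by
  intro h
  have hQ : P - C a ≠ 0 := fun h0 => by
    rw [sub_eq_zero.mp h0, natDegree_C] at hP
    omega
  have hD : derivative P - C a ≠ 0 := fun h0 => by
    refine hQ (Polynomial.funext fun z => ?_)
    have : P.eval z = a := (h z).2 (by rw [sub_eq_zero.mp h0, eval_C])
    simp [this]
  have hnodup : (P - C a).roots.Nodup := by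
    rw [Multiset.nodup_iff_count_le_one]
    intro z
    rw [count_roots]
    by_contra! hz
    obtain ⟨h1, h2⟩ := (one_lt_rootMultiplicity_iff_isRoot hQ).1 hz
    have hPz : P.eval z = a := by simpa [sub_eq_zero] using h1
    exact ha (((h z).1 hPz).symm.trans (by simpa using h2))
  have hle : (P - C a).roots ≤ (derivative P - C a).roots := by
    rw [Multiset.le_iff_subset hnodup]
    intro z hz
    have hPz : P.eval z = a := by simpa [sub_eq_zero] using (mem_roots hQ).1 hz
    rw [mem_roots hD]
    simp [(h z).1 hPz]
  have hcard : (P - C a).roots.card = P.natDegree := by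
    rw [← (IsAlgClosed.splits (P - C a)).natDegree_eq_card_roots, natDegree_sub_C]
  have h1 := Multiset.card_le_card hle
  have h2 := card_roots' (derivative P - C a)
  rw [natDegree_sub_C] at h2
  have h3 := natDegree_derivative_le P
  omega

/-- A non-constant polynomial cannot share two distinct finite values with its derivative. -/
theorem polynomial_cannot_share_two_values
    (P : ℂ[X]) (hP : 1 ≤ P.natDegree) (a b : ℂ) (hab : a ≠ b) :
    ¬ ((∀ z : ℂ, P.eval z = a ↔ (derivative P).eval z = a) ∧
       (∀ z : ℂ, P.eval z = b ↔ (derivative P).eval z = b)) := by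
  rintro ⟨ha, hb⟩
  by_cases h0 : a = 0
  · exact not_forall_eval_eq_iff_eval_derivative_eq P hP (h0 ▸ hab.symm) hb
  · exact not_forall_eval_eq_iff_eval_derivative_eq P hP h0 ha
end

section
/- Let P ∈ ℂ[X] be a non-constant polynomial. Then P and P' share the value 0 in ℂ (i.e., for every z ∈ ℂ, P(z) = 0 ⇔ P'(z) = 0) if and only if there exist c ∈ ℂ∖{0}, A ∈ ℂ and a natural number n ≥ 2 such that P = c·(X − A)^n. -/
open Polynomial

/-- If every root of the derivative is a root of `P`, then the roots of `P` are those of its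
derivative together with one further copy of each distinct root. -/
theorem Polynomial.roots_eq_derivative_roots_add_dedup {K : Type*} [Field K] [CharZero K]
    [DecidableEq K] {P : K[X]} (hP : 1 ≤ P.natDegree)
    (h : ∀ z : K, (derivative P).eval z = 0 → P.eval z = 0) :
    P.roots = (derivative P).roots + P.roots.dedup := by
  have hP0 : P ≠ 0 := by
    rintro rfl
    simp at hP
  ext z
  rw [Multiset.count_add, Multiset.count_dedup, count_roots, count_roots]
  by_cases hz : P.eval z = 0
  · have hpos : 0 < P.rootMultiplicity z := (rootMultiplicity_pos hP0).2 hz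
    rw [derivative_rootMultiplicity_of_root hz, if_pos ((mem_roots hP0).2 hz)]
    omega
  · rw [if_neg fun hm => hz ((mem_roots hP0).1 hm), rootMultiplicity_eq_zero hz,
      rootMultiplicity_eq_zero fun hd => hz (h z hd)]

/-- A non-constant polynomial shares the value 0 with its derivative
if and only if `P = c·(X − A)^n` with `c ≠ 0` and `n ≥ 2`. -/
theorem polynomial_shares_zero_iff
    (P : ℂ[X]) (hP : 1 ≤ P.natDegree) :
    (∀ z : ℂ, P.eval z = 0 ↔ (derivative P).eval z = 0) ↔
      ∃ (c A : ℂ) (n : ℕ), c ≠ 0 ∧ 2 ≤ n ∧ P = C c * (X - C A) ^ n := by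
  constructor
  · intro h
    have hP0 : P ≠ 0 := by
      rintro rfl
      simp at hP
    have hcard := congrArg Multiset.card
      (roots_eq_derivative_roots_add_dedup hP fun z => (h z).2)
    rw [Multiset.card_add, ← (IsAlgClosed.splits P).natDegree_eq_card_roots,
      ← (IsAlgClosed.splits (derivative P)).natDegree_eq_card_roots, natDegree_derivative] at hcard
    obtain ⟨A, hA⟩ := Multiset.card_eq_one.1 (show P.roots.dedup.card = 1 by omega)
    have hroots : P.roots = Multiset.replicate P.natDegree A := by
      refine Multiset.eq_replicate.2
        ⟨(IsAlgClosed.splits P).natDegree_eq_card_roots.symm, fun b hb => ?_⟩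
      rwa [← Multiset.mem_dedup, hA, Multiset.mem_singleton] at hb
    have hPA : P = C P.leadingCoeff * (X - C A) ^ P.natDegree := by
      have := (IsAlgClosed.splits P).eq_prod_roots
      rwa [hroots, Multiset.map_replicate, Multiset.prod_replicate] at this
    refine ⟨P.leadingCoeff, A, P.natDegree, leadingCoeff_ne_zero.2 hP0, ?_, hPA⟩
    by_contra hlt
    have h1 : P.natDegree = 1 := by omega
    have hd := (h A).1 (by rw [hPA, h1]; simp)
    rw [hPA, h1] at hd
    simp [hP0] at hd
  · rintro ⟨c, A, n, hc, hn, rfl⟩ z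
    have h0 : n ≠ 0 := by omega
    have h1 : n - 1 ≠ 0 := by omega
    simp [derivative_X_sub_C_pow, hc, h0, h1]
end

section
/- Let R = P/Q be a non-constant rational function, with P, Q ∈ ℂ[X] coprime, Q ≠ 0 and max(deg P, deg Q) ≥ 1. Then the following are equivalent: (i) for every z ∈ ℂ with Q(z) ≠ 0, if P'(z)·Q(z) − P(z)·Q'(z) = 0 then P(z) = 0, and, if deg(P'·Q − P·Q') < 2·deg Q, then deg P < deg Q; (ii) there exist c ∈ ℂ∖{0}, A ∈ ℂ and an integer n ≠ 0 such that for every z ∈ ℂ with Q(z) ≠ 0 and z ≠ A one has P(z)/Q(z) = c·(z − A)^n. (Condition (i) expresses that R'(z) = 0 implies R(z) = 0 at every point of the Riemann sphere ℂ∪{∞}.) -/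
open Polynomial

namespace Polynomial

theorem natDegree_X_mul_derivative_le {R : Type*} [CommRing R] (P : R[X]) :
    (X * derivative P).natDegree ≤ P.natDegree := by
  rw [natDegree_le_iff_coeff_eq_zero]
  intro N hN
  obtain _ | N := N
  · simp
  · rw [coeff_X_mul, coeff_derivative, coeff_eq_zero_of_natDegree_lt hN, zero_mul]

theorem coeff_X_mul_derivative {R : Type*} [CommRing R] (P : R[X]) (n : ℕ) :
    (X * derivative P).coeff n = n * P.coeff n := by
  obtain _ | n := n
  · simp
  · rw [coeff_X_mul, coeff_derivative]
    push_cast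
    ring

theorem natDegree_add_le_natDegree_derivative_mul_sub_add_one {K : Type*} [Field K] [CharZero K]
    {P Q : K[X]}
    (hP : P ≠ 0) (hQ : Q ≠ 0) (h : P.natDegree ≠ Q.natDegree) :
    P.natDegree + Q.natDegree ≤ (derivative P * Q - P * derivative Q).natDegree + 1 := by
  have hcoeff : (X * (derivative P * Q - P * derivative Q)).coeff (P.natDegree + Q.natDegree) =
      ((P.natDegree : K) - Q.natDegree) * (P.leadingCoeff * Q.leadingCoeff) := by
    rw [show X * (derivative P * Q - P * derivative Q) =
        (X * derivative P) * Q - P * (X * derivative Q) by ring, coeff_sub,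
      coeff_mul_add_eq_of_natDegree_le (natDegree_X_mul_derivative_le P) le_rfl,
      coeff_mul_add_eq_of_natDegree_le le_rfl (natDegree_X_mul_derivative_le Q),
      coeff_X_mul_derivative, coeff_X_mul_derivative, leadingCoeff, leadingCoeff]
    ring
  have hne : (X * (derivative P * Q - P * derivative Q)).coeff (P.natDegree + Q.natDegree) ≠ 0 := by
    rw [hcoeff]
    refine mul_ne_zero (sub_ne_zero.2 (by exact_mod_cast h)) (mul_ne_zero ?_ ?_) <;> simpa
  refine (le_natDegree_of_ne_zero hne).trans (natDegree_mul_le.trans ?_)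
  rw [natDegree_X, add_comm]

theorem rootMultiplicity_derivative_mul_sub_add_one {K : Type*} [Field K] [CharZero K]
    {P Q : K[X]} {z : K} (hP : P ≠ 0) (hPz : P.eval z = 0) (hQz : Q.eval z ≠ 0) :
    (derivative P * Q - P * derivative Q).rootMultiplicity z + 1 = P.rootMultiplicity z := by
  obtain ⟨S, hS, hSz⟩ := exists_eq_pow_rootMultiplicity_mul_and_not_dvd P hP z
  have hpos : 0 < P.rootMultiplicity z := (rootMultiplicity_pos hP).2 hPz
  obtain ⟨k, hk⟩ : ∃ k, P.rootMultiplicity z = k + 1 := ⟨_, (Nat.succ_pred_eq_of_pos hpos).symm⟩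
  rw [hk] at hS ⊢
  rw [dvd_iff_isRoot, IsRoot] at hSz
  set T : K[X] := ((k : K[X]) + 1) * S * Q + (X - C z) * (derivative S * Q - S * derivative Q)
    with hT
  have hfac : derivative P * Q - P * derivative Q = (X - C z) ^ k * T := by
    rw [hS, hT, derivative_mul, derivative_X_sub_C_pow]
    push_cast
    simp only [map_add, map_natCast, map_one]
    ring
  have hTz : T.eval z ≠ 0 := by
    have : (k : K) + 1 ≠ 0 := by exact_mod_cast k.succ_ne_zero
    simp [hT, this, hSz, hQz]
  have hT0 : T ≠ 0 := by
    intro h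
    simp [h] at hTz
  rw [hfac, rootMultiplicity_mul (mul_ne_zero (pow_ne_zero _ (X_sub_C_ne_zero z)) hT0),
    rootMultiplicity_X_sub_C_pow, rootMultiplicity_eq_zero hTz]

theorem card_roots_toFinset_add_natDegree {P Q : ℂ[X]} (hPQ : IsCoprime P Q)
    (hP : P ≠ 0) (hQ : Q ≠ 0) (hW : derivative P * Q - P * derivative Q ≠ 0)
    (hroot : ∀ z, (derivative P * Q - P * derivative Q).eval z = 0 → (P * Q).eval z = 0) :
    (derivative P * Q - P * derivative Q).natDegree + (P * Q).roots.toFinset.card =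
      P.natDegree + Q.natDegree := by
  set W := derivative P * Q - P * derivative Q with hWdef
  have h0 : P * Q ≠ 0 := mul_ne_zero hP hQ
  rw [← natDegree_mul hP hQ, (IsAlgClosed.splits W).natDegree_eq_card_roots,
    (IsAlgClosed.splits (P * Q)).natDegree_eq_card_roots,
    ← Multiset.sum_count_eq_card (s := (P * Q).roots.toFinset) (m := W.roots),
    ← Multiset.toFinset_sum_count_eq, Finset.card_eq_sum_ones, ← Finset.sum_add_distrib]
  · refine Finset.sum_congr rfl fun z hz => ?_
    have hz : P.eval z * Q.eval z = 0 := by simpa [h0, hP, hQ] using hz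
    rw [count_roots, count_roots, rootMultiplicity_mul h0]
    obtain ⟨a, b, hab⟩ := hPQ
    have hab := congrArg (eval z) hab
    simp only [eval_add, eval_mul, eval_one] at hab
    rcases mul_eq_zero.1 hz with h | h
    · have hq : Q.eval z ≠ 0 := fun h' => by simp [h, h'] at hab
      rw [rootMultiplicity_derivative_mul_sub_add_one hP h hq, rootMultiplicity_eq_zero hq,
        add_zero]
    · have hp : P.eval z ≠ 0 := fun h' => by simp [h, h'] at hab
      have hneg : W = C (-1) * (derivative Q * P - Q * derivative P) := by
        simp only [hWdef, map_neg, map_one]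
        ring
      have hW' := hW
      rw [hneg] at hW' ⊢
      rw [rootMultiplicity_mul hW', rootMultiplicity_C, zero_add,
        rootMultiplicity_derivative_mul_sub_add_one hQ h hp, rootMultiplicity_eq_zero hp, zero_add]
  · intro z hz
    rw [Multiset.mem_toFinset, mem_roots h0]
    exact hroot z ((mem_roots hW).1 hz)

theorem eq_C_leadingCoeff_mul_X_sub_C_pow {K : Type*} [Field K] [IsAlgClosed K] {P : K[X]} {A : K}
    (h : ∀ z ∈ P.roots, z = A) : P = C P.leadingCoeff * (X - C A) ^ P.natDegree := by
  have hs := IsAlgClosed.splits P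
  have hr := Multiset.eq_replicate_card.2 h
  conv_lhs => rw [hs.eq_prod_roots, hr]
  simp [hs.natDegree_eq_card_roots]

theorem eq_of_eval_eq_of_eval_ne_zero {K : Type*} [Field K] [Infinite K] {F G H : K[X]}
    (hH : H ≠ 0) (h : ∀ z, H.eval z ≠ 0 → F.eval z = G.eval z) : F = G := by
  refine mul_left_cancel₀ hH (funext fun z => ?_)
  by_cases hz : H.eval z = 0
  · simp [hz]
  · simp [h z hz]

end Polynomial

theorem exists_monomial_of_deriv_zero_implies_zero
    {P Q : ℂ[X]} (hPQ : IsCoprime P Q) (hQ : Q ≠ 0)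
    (hd : 1 ≤ max P.natDegree Q.natDegree)
    (hfin : ∀ z : ℂ, Q.eval z ≠ 0 →
        ((derivative P * Q - P * derivative Q).eval z = 0 → P.eval z = 0))
    (hinf : (derivative P * Q - P * derivative Q).degree < Q.degree + Q.degree →
        P.degree < Q.degree) :
    ∃ (c A : ℂ) (n : ℤ), c ≠ 0 ∧ n ≠ 0 ∧
        ∀ z : ℂ, Q.eval z ≠ 0 → z ≠ A →
          P.eval z / Q.eval z = c * (z - A) ^ n := by
  have hP : P ≠ 0 := by
    rintro rfl
    have := natDegree_eq_zero_of_isUnit (isCoprime_zero_left.1 hPQ)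
    simp [this] at hd
  have hW : derivative P * Q - P * derivative Q ≠ 0 := by
    intro h
    refine hP (eq_of_eval_eq_of_eval_ne_zero hQ fun z hz => ?_)
    rw [hfin z hz (by simp [h]), eval_zero]
  have hne : P.natDegree ≠ Q.natDegree := by
    intro h
    have hdeg : P.degree = Q.degree := by
      rw [degree_eq_natDegree hP, degree_eq_natDegree hQ, h]
    refine (hinf ?_).ne hdeg
    rw [show derivative P * Q - P * derivative Q = -wronskian P Q by rw [wronskian]; ring,
      degree_neg]
    simpa [hdeg] using degree_wronskian_lt_add hP hQ
  have hcount := card_roots_toFinset_add_natDegree hPQ hP hQ hW fun z hz => by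
    by_cases hq : Q.eval z = 0
    · simp [hq]
    · simp [hfin z hq hz]
  have hle := natDegree_add_le_natDegree_derivative_mul_sub_add_one hP hQ hne
  obtain ⟨A, hA⟩ : ∃ A, ∀ z ∈ (P * Q).roots, z = A := by
    have hcard : (P * Q).roots.toFinset.card ≤ 1 := by omega
    obtain ⟨A, hA⟩ := Finset.card_le_one_iff_subset_singleton.1 hcard
    exact ⟨A, fun z hz => by simpa using hA (Multiset.mem_toFinset.2 hz)⟩
  rw [roots_mul (mul_ne_zero hP hQ)] at hA
  have hPA := eq_C_leadingCoeff_mul_X_sub_C_pow fun z hz => hA z (Multiset.mem_add.2 (.inl hz))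
  have hQA := eq_C_leadingCoeff_mul_X_sub_C_pow fun z hz => hA z (Multiset.mem_add.2 (.inr hz))
  refine ⟨P.leadingCoeff / Q.leadingCoeff, A, (P.natDegree : ℤ) - Q.natDegree, by simp [hP, hQ],
    by omega, fun z _ hz => ?_⟩
  have hPz := congrArg (eval z) hPA
  have hQz := congrArg (eval z) hQA
  simp only [eval_mul, eval_C, eval_pow, eval_sub, eval_X] at hPz hQz
  rw [hPz, hQz, zpow_sub₀ (sub_ne_zero.2 hz), zpow_natCast, zpow_natCast, mul_div_mul_comm]

theorem eval_eq_zero_of_eval_derivative_eq_zero {K : Type*} [Field K] [CharZero K] {a A z : K}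
    {m : ℕ} (ha : a ≠ 0)
    (h : (derivative (C a * (X - C A) ^ (m + 1))).eval z = 0) :
    (C a * (X - C A) ^ (m + 1)).eval z = 0 := by
  have hm : (m : K) + 1 ≠ 0 := by exact_mod_cast m.succ_ne_zero
  have h : (z - A) ^ m = 0 := by
    simpa [derivative_X_sub_C_pow, ha, hm] using h
  simp [pow_succ, h]

theorem deriv_zero_implies_zero_of_monomial
    {P Q : ℂ[X]} (hPQ : IsCoprime P Q) (hQ : Q ≠ 0)
    (hd : 1 ≤ max P.natDegree Q.natDegree) {c A : ℂ} {n : ℤ} (hc : c ≠ 0) (hn : n ≠ 0)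
    (h : ∀ z : ℂ, Q.eval z ≠ 0 → z ≠ A → P.eval z / Q.eval z = c * (z - A) ^ n) :
    (∀ z : ℂ, Q.eval z ≠ 0 →
        ((derivative P * Q - P * derivative Q).eval z = 0 → P.eval z = 0)) ∧
      ((derivative P * Q - P * derivative Q).degree < Q.degree + Q.degree →
        P.degree < Q.degree) := by
  have hH : Q * (X - C A) ≠ 0 := mul_ne_zero hQ (X_sub_C_ne_zero A)
  rcases n with m | m
  · obtain _ | m := m
    · simp at hn
    have hfac : P = C c * (X - C A) ^ (m + 1) * Q :=
      eq_of_eval_eq_of_eval_ne_zero hH fun z hz => by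
        simp only [eval_mul, eval_sub, eval_X, eval_C, mul_ne_zero_iff, sub_ne_zero] at hz
        have := h z hz.1 hz.2
        rw [div_eq_iff hz.1, Int.ofNat_eq_natCast, zpow_natCast] at this
        simpa using this
    obtain ⟨q, hq, rfl⟩ := isUnit_iff.1 (hPQ.isUnit_of_dvd' (Dvd.intro_left _ hfac.symm) dvd_rfl)
    have hq := hq.ne_zero
    replace hfac : P = C (c * q) * (X - C A) ^ (m + 1) := by
      rw [hfac, C_mul]
      ring
    refine ⟨fun z _ hz => ?_, fun hdeg => ?_⟩
    · rw [hfac] at hz ⊢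
      refine eval_eq_zero_of_eval_derivative_eq_zero (mul_ne_zero hc hq) ?_
      simpa only [derivative_C, mul_zero, sub_zero, eval_mul, eval_C, mul_eq_zero, hq,
        or_false] using hz
    · rw [degree_C hq, add_zero, Nat.WithBot.lt_zero_iff, degree_eq_bot] at hdeg
      have h0 : derivative P = 0 := by
        have : derivative P * C q = 0 := by simpa only [derivative_C, mul_zero, sub_zero] using hdeg
        exact (mul_eq_zero.1 this).resolve_right hQ
      have := derivative_eq_zero.1 h0
      simp [this] at hd
  · have hfac : Q = C c⁻¹ * (X - C A) ^ (m + 1) * P :=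
      eq_of_eval_eq_of_eval_ne_zero hH fun z hz => by
        simp only [eval_mul, eval_sub, eval_X, eval_C, mul_ne_zero_iff, sub_ne_zero] at hz
        have hzA := pow_ne_zero (m + 1) (sub_ne_zero.2 hz.2)
        have := h z hz.1 hz.2
        rw [div_eq_iff hz.1, zpow_negSucc] at this
        simp only [eval_mul, eval_C, eval_pow, eval_sub, eval_X, this]
        field_simp
    obtain ⟨p, hp, rfl⟩ := isUnit_iff.1 (hPQ.isUnit_of_dvd' dvd_rfl (Dvd.intro_left _ hfac.symm))
    have hp := hp.ne_zero
    replace hfac : Q = C (c⁻¹ * p) * (X - C A) ^ (m + 1) := by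
      rw [hfac, C_mul]
      ring
    refine ⟨fun z hQz hz => absurd ?_ hQz, fun _ => ?_⟩
    · rw [hfac] at hz ⊢
      refine eval_eq_zero_of_eval_derivative_eq_zero (mul_ne_zero (inv_ne_zero hc) hp) ?_
      simpa only [derivative_C, zero_mul, zero_sub, eval_neg, neg_eq_zero, eval_mul (p := C p),
        eval_C, mul_eq_zero, hp, false_or] using hz
    · rw [degree_C hp]
      refine natDegree_pos_iff_degree_pos.1 ?_
      simpa [Nat.one_le_iff_ne_zero, Nat.pos_iff_ne_zero] using hd

/-- For a non-constant rational function `R = P/Q` on the Riemann sphere,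
`R'(z) = 0 ⇒ R(z) = 0` everywhere on the sphere if and only if
`R(z) = c·(z − A)^n` with `c ≠ 0` and a non-zero integer `n`. -/
theorem rational_deriv_zero_implies_zero_iff
    (P Q : ℂ[X]) (hPQ : IsCoprime P Q) (hQ : Q ≠ 0)
    (hd : 1 ≤ max P.natDegree Q.natDegree) :
    ((∀ z : ℂ, Q.eval z ≠ 0 →
        ((derivative P * Q - P * derivative Q).eval z = 0 → P.eval z = 0)) ∧
      ((derivative P * Q - P * derivative Q).degree < Q.degree + Q.degree →
        P.degree < Q.degree)) ↔
      ∃ (c A : ℂ) (n : ℤ), c ≠ 0 ∧ n ≠ 0 ∧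
        ∀ z : ℂ, Q.eval z ≠ 0 → z ≠ A →
          P.eval z / Q.eval z = c * (z - A) ^ n := by
  constructor
  · rintro ⟨hfin, hinf⟩
    exact exists_monomial_of_deriv_zero_implies_zero hPQ hQ hd hfin hinf
  · rintro ⟨c, A, n, hc, hn, h⟩
    exact deriv_zero_implies_zero_of_monomial hPQ hQ hd hc hn h
end

section
/- Let R = P/Q be a non-constant rational function, with P, Q ∈ ℂ[X] coprime, Q ≠ 0 and max(deg P, deg Q) ≥ 1, and let a, b ∈ ℂ with a ≠ b. Then R and R' cannot share both values a and b on the sphere ℂ∪{∞}; i.e., it is not the case that for each v ∈ {a, b} one has: (for every z ∈ ℂ with Q(z) ≠ 0, P(z) = v·Q(z) ⇔ P'(z)·Q(z) − P(z)·Q'(z) = v·Q(z)²) and (deg(P − v·Q) < deg Q ⇔ deg(P'·Q − P·Q' − v·Q²) < 2·deg Q). -/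
open Polynomial

/-- `P / Q` and its derivative share the value `v` at every finite point. -/
def SharesFiniteValue (P Q : ℂ[X]) (v : ℂ) : Prop :=
  ∀ z : ℂ, Q.eval z ≠ 0 →
    (P.eval z = v * Q.eval z ↔
      (derivative P * Q - P * derivative Q).eval z = v * (Q.eval z) ^ 2)

/-- `P / Q` and its derivative share the value `v` at infinity. -/
def SharesValueAtInfinity (P Q : ℂ[X]) (v : ℂ) : Prop :=
  (P - C v * Q).degree < Q.degree ↔
    (derivative P * Q - P * derivative Q - C v * Q ^ 2).degree < Q.degree + Q.degree

theorem isCoprime_of_eval {p q : ℂ[X]} (h : ∀ z, p.eval z = 0 → q.eval z ≠ 0) :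
    IsCoprime p q := by
  rw [isCoprime_iff_aeval_ne_zero_of_isAlgClosed (k := ℂ) (K := ℂ)]
  intro z
  simp only [coe_aeval_eq_eval]
  by_cases hz : p.eval z = 0
  · exact .inr (h z hz)
  · exact .inl hz

theorem eval_ne_zero_of_isCoprime {p q : ℂ[X]} (h : IsCoprime p q) {z : ℂ}
    (hz : p.eval z = 0) : q.eval z ≠ 0 := by
  rw [isCoprime_iff_aeval_ne_zero_of_isAlgClosed (k := ℂ) (K := ℂ)] at h
  simpa [coe_aeval_eq_eval, hz] using h z

theorem natDegree_eq_zero_of_eval_ne_zero {p : ℂ[X]} (h : ∀ z, p.eval z ≠ 0) :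
    p.natDegree = 0 := by
  by_contra hp
  obtain ⟨z, hz⟩ := IsAlgClosed.exists_root p (fun h0 => hp (natDegree_eq_of_degree_eq_some h0))
  exact h z hz

theorem dvd_of_simple_roots {f g : ℂ[X]} (hf : f ≠ 0)
    (hs : ∀ z, f.eval z = 0 → (derivative f).eval z ≠ 0)
    (h : ∀ z, f.eval z = 0 → g.eval z = 0) : f ∣ g :=
  (isCoprime_of_eval hs).dvd_of_dvd_mul_left
    ((isRoot_of_isRoot_iff_dvd_derivative_mul hf).1 h)

theorem exists_radical_factorization {P : ℂ[X]} (hP : P ≠ 0) :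
    ∃ A A' G : ℂ[X], P = G * A ∧ derivative P = G * A' ∧ IsCoprime A A' ∧
      ∀ z, P.eval z = 0 → A.eval z = 0 := by
  obtain ⟨A, A', hA, hA', hu⟩ := extract_gcd P (derivative P)
  set G := gcd P (derivative P)
  refine ⟨A, A', G, hA, hA', (gcd_isUnit_iff _ _).1 hu, fun z hz => ?_⟩
  by_contra hAz
  have hd : derivative P ≠ 0 := fun h0 => by
    rw [eq_C_of_derivative_eq_zero h0, eval_C] at hz
    exact hP (by rw [eq_C_of_derivative_eq_zero h0, hz, C_0])
  have hpos := (rootMultiplicity_pos hP).2 hz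
  have hm := derivative_rootMultiplicity_of_root (p := P) (t := z) hz
  have h1 : P.rootMultiplicity z = G.rootMultiplicity z := by
    conv_lhs => rw [hA]
    rw [rootMultiplicity_mul (hA ▸ hP), rootMultiplicity_eq_zero (p := A) hAz, add_zero]
  have h2 : (derivative P).rootMultiplicity z =
      G.rootMultiplicity z + A'.rootMultiplicity z := by
    conv_lhs => rw [hA']
    rw [rootMultiplicity_mul (hA' ▸ hd)]
  omega

theorem degree_derivative_mul_sub_lt {P Q : ℂ[X]} (hP : P ≠ 0) (hQ : Q ≠ 0) :
    (derivative P * Q - P * derivative Q).degree < P.degree + Q.degree := by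
  have h := degree_wronskian_lt_add hP hQ
  rwa [← degree_neg, wronskian, neg_sub] at h

theorem natDegree_add_le_of_natDegree_ne {P Q : ℂ[X]} (hP : P ≠ 0) (hQ : Q ≠ 0)
    (hne : P.natDegree ≠ Q.natDegree) :
    P.natDegree + Q.natDegree ≤ (derivative P * Q - P * derivative Q).natDegree + 1 := by
  have hX : ∀ F : ℂ[X], (X * derivative F).natDegree ≤ F.natDegree ∧
      (X * derivative F).coeff F.natDegree = F.natDegree * F.leadingCoeff := fun F => by
    rcases Nat.eq_zero_or_pos F.natDegree with h | h
    · rw [derivative_eq_zero.2 h]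
      simp [h]
    · obtain ⟨n, hn⟩ := Nat.exists_eq_succ_of_ne_zero h.ne'
      refine ⟨natDegree_mul_le.trans ?_, ?_⟩
      · have := natDegree_derivative_le F
        rw [natDegree_X]
        omega
      · rw [leadingCoeff, hn, Nat.succ_eq_add_one, coeff_X_mul, coeff_derivative]
        push_cast
        ring
  have hc : (X * (derivative P * Q - P * derivative Q)).coeff (P.natDegree + Q.natDegree) =
      ((P.natDegree : ℂ) - Q.natDegree) * (P.leadingCoeff * Q.leadingCoeff) := by
    rw [show X * (derivative P * Q - P * derivative Q) =
      (X * derivative P) * Q - P * (X * derivative Q) by ring, coeff_sub,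
      coeff_mul_add_eq_of_natDegree_le (hX P).1 le_rfl,
      coeff_mul_add_eq_of_natDegree_le le_rfl (hX Q).1, (hX P).2, (hX Q).2,
      coeff_natDegree, coeff_natDegree]
    ring
  have hne' : (X * (derivative P * Q - P * derivative Q)).coeff
      (P.natDegree + Q.natDegree) ≠ 0 := by
    rw [hc]
    refine mul_ne_zero (sub_ne_zero.2 (by exact_mod_cast hne)) (mul_ne_zero ?_ ?_) <;> simpa
  have := (le_natDegree_of_ne_zero hne').trans natDegree_mul_le
  rw [natDegree_X] at this
  omega

theorem natDegree_sub_C_mul_of_shares {P Q : ℂ[X]} (hP : P ≠ 0) (hQ : Q ≠ 0) {v : ℂ}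
    (hv : v ≠ 0) (h : SharesValueAtInfinity P Q v) :
    (P - C v * Q).natDegree = max P.natDegree Q.natDegree := by
  have hvQ : (C v * Q).natDegree = Q.natDegree := natDegree_C_mul hv
  rcases lt_trichotomy P.natDegree Q.natDegree with hlt | heq | hgt
  · rw [natDegree_sub_eq_right_of_natDegree_lt (by rwa [hvQ]), hvQ, max_eq_right hlt.le]
  · rw [heq, max_self]
    by_contra hne
    have hle : (P - C v * Q).natDegree ≤ Q.natDegree := by
      have := natDegree_sub_le P (C v * Q)
      rwa [hvQ, heq, max_self] at this
    have h1 := h.1 (degree_lt_degree (lt_of_le_of_ne hle hne))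
    have h2 := degree_derivative_mul_sub_lt hP hQ
    rw [degree_eq_natDegree hP, heq, ← degree_eq_natDegree hQ] at h2
    have h3 := (degree_sub_le _ _).trans_lt (max_lt h2 h1)
    rw [sub_sub_cancel, degree_C_mul hv, pow_two, degree_mul] at h3
    exact lt_irrefl _ h3
  · rw [natDegree_sub_eq_left_of_natDegree_lt (by rwa [hvQ]), max_eq_left hgt.le]

section ValuePoints

variable {P Q : ℂ[X]} {v z : ℂ}

theorem eval_denominator_ne_zero (hPQ : IsCoprime P Q) (hz : (P - C v * Q).eval z = 0) :
    Q.eval z ≠ 0 := fun h => by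
  simp [h] at hz
  exact eval_ne_zero_of_isCoprime hPQ hz h

theorem eval_numerator_eq (hz : (P - C v * Q).eval z = 0) : P.eval z = v * Q.eval z := by
  simpa [sub_eq_zero] using hz

theorem eval_derivative_ne_zero (hPQ : IsCoprime P Q) (hv : v ≠ 0)
    (h : SharesFiniteValue P Q v) (hz : (P - C v * Q).eval z = 0) :
    (derivative (P - C v * Q)).eval z ≠ 0 := fun h0 => by
  have hQz := eval_denominator_ne_zero hPQ hz
  have hPz := eval_numerator_eq hz
  have hM := (h z hQz).1 hPz
  simp at hM h0
  have : v * Q.eval z ^ 2 = 0 := by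
    rw [← hM, hPz]
    linear_combination Q.eval z * h0
  simp_all

theorem eval_sub_eq_zero (hPQ : IsCoprime P Q) (h : SharesFiniteValue P Q v)
    (hz : (P - C v * Q).eval z = 0) :
    (P * Q - (derivative P * Q - P * derivative Q)).eval z = 0 := by
  have hPz := eval_numerator_eq hz
  have hM := (h z (eval_denominator_ne_zero hPQ hz)).1 hPz
  rw [eval_sub, hM, eval_mul, hPz]
  ring

end ValuePoints

/-- A Möbius transformation `c + s / Q` with `Q` linear does not share a nonzero value. -/
theorem not_sharesFiniteValue_of_linear {Q : ℂ[X]} (hQ : Q.natDegree = 1) {c s v : ℂ}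
    (hs : s ≠ 0) (hv : v ≠ 0) (h : SharesFiniteValue (C c * Q + C s) Q v) : False := by
  obtain ⟨m, hm, n, rfl⟩ := natDegree_eq_one.1 hQ
  obtain ⟨y, hy⟩ := IsAlgClosed.exists_pow_nat_eq (-(s * m) / v) (n := 2) two_pos
  have hy0 : y ≠ 0 := by
    rintro rfl
    have : -(s * m) / v ≠ 0 := div_ne_zero (neg_ne_zero.2 (mul_ne_zero hs hm)) hv
    exact this (by simpa using hy.symm)
  have hvy : v * y ^ 2 = -(s * m) := by
    rw [hy]
    field_simp
  have key : ∀ t : ℂ, t ≠ 0 → v * t ^ 2 = -(s * m) → c * t + s = v * t := fun t ht hvt => by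
    have hQz : (C m * X + C n).eval ((t - n) / m) = t := by
      simp
      field_simp
      ring
    have h1 := (h ((t - n) / m) (by rwa [hQz])).2 (by
      rw [eval_sub, eval_mul, eval_mul, hQz, hvt, eval_add, eval_mul, hQz]
      simp
      ring)
    rw [eval_add, eval_mul, hQz] at h1
    simpa using h1
  have h1 := key y hy0 hvy
  have h2 := key (-y) (neg_ne_zero.2 hy0) (by rw [neg_sq, hvy])
  exact hs (by linear_combination (h1 + h2) / 2)

theorem not_shares_of_ne_zero {P Q : ℂ[X]} (hPQ : IsCoprime P Q) (hP : P ≠ 0) (hQ : Q ≠ 0)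
    (hd : 1 ≤ max P.natDegree Q.natDegree) {a b : ℂ} (hab : a ≠ b) (ha0 : a ≠ 0) (hb0 : b ≠ 0)
    (ha : SharesFiniteValue P Q a) (ha' : SharesValueAtInfinity P Q a)
    (hb : SharesFiniteValue P Q b) (hb' : SharesValueAtInfinity P Q b) : False := by
  have hda := natDegree_sub_C_mul_of_shares hP hQ ha0 ha'
  have hdb := natDegree_sub_C_mul_of_shares hP hQ hb0 hb'
  have hFa : P - C a * Q ≠ 0 := fun h => by simp [h] at hda; omega
  have hFb : P - C b * Q ≠ 0 := fun h => by simp [h] at hdb; omega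
  have hMlt := degree_derivative_mul_sub_lt hP hQ
  set M := derivative P * Q - P * derivative Q with hM
  rw [← degree_mul] at hMlt
  have hNdeg : (P * Q - M).degree = (P * Q).degree := degree_sub_eq_left_of_degree_lt hMlt
  have hN0 : P * Q - M ≠ 0 := fun h => by
    rw [h, degree_zero, eq_comm, degree_eq_bot] at hNdeg
    exact mul_ne_zero hP hQ hNdeg
  have hcop : IsCoprime (P - C a * Q) (P - C b * Q) := isCoprime_of_eval fun z hz hz' => by
    have h1 := eval_numerator_eq hz
    rw [eval_numerator_eq hz'] at h1
    exact hab (mul_right_cancel₀ (eval_denominator_ne_zero hPQ hz) h1.symm)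
  obtain ⟨K, hK⟩ := hcop.mul_dvd
    (dvd_of_simple_roots hFa (fun z => eval_derivative_ne_zero hPQ ha0 ha)
      fun z => eval_sub_eq_zero hPQ ha)
    (dvd_of_simple_roots hFb (fun z => eval_derivative_ne_zero hPQ hb0 hb)
      fun z => eval_sub_eq_zero hPQ hb)
  rw [← hM] at hK
  have hK0 : K ≠ 0 := by
    rintro rfl
    exact hN0 (by rw [hK, mul_zero])
  have hdeg := natDegree_eq_of_degree_eq hNdeg
  rw [hK, natDegree_mul (mul_ne_zero hFa hFb) hK0, natDegree_mul hFa hFb, hda, hdb,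
    natDegree_mul hP hQ] at hdeg
  have hpq : P.natDegree = Q.natDegree := by omega
  obtain ⟨k, rfl⟩ := natDegree_eq_zero.1 (show K.natDegree = 0 by omega)
  have hk : k ≠ 0 := by simpa using hK0
  have hlQ : Q.leadingCoeff ≠ 0 := by simpa
  set c := P.leadingCoeff / Q.leadingCoeff with hc
  obtain ⟨S, hS⟩ : ∃ S, P = S + C c * Q := ⟨P - C c * Q, by ring⟩
  have hScop : IsCoprime S Q := by
    rw [hS] at hPQ
    exact IsCoprime.of_add_mul_right_left hPQ
  have hM' : M = derivative S * Q - S * derivative Q := by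
    rw [hM, hS]
    simp
    ring
  have hzero : c - k * (c - a) * (c - b) = 0 := by
    have hMc : M.coeff (P.natDegree + Q.natDegree) = 0 := by
      apply coeff_eq_zero_of_degree_lt
      rwa [degree_mul, degree_eq_natDegree hP, degree_eq_natDegree hQ] at hMlt
    have hM2 : M = P * Q - C k * ((P - C a * Q) * (P - C b * Q)) := by
      linear_combination -hK
    have hle : ∀ v : ℂ, (P - C v * Q).natDegree ≤ Q.natDegree := fun v => by
      refine (natDegree_sub_le _ _).trans (max_le hpq.le (natDegree_C_mul_le _ _))
    have hcP : P.coeff Q.natDegree = c * Q.leadingCoeff := by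
      rw [hc, div_mul_cancel₀ _ hlQ, ← hpq, coeff_natDegree]
    rw [hM2, hpq, coeff_sub, coeff_C_mul, coeff_mul_add_eq_of_natDegree_le hpq.le le_rfl,
      coeff_mul_add_eq_of_natDegree_le (hle a) (hle b), coeff_sub, coeff_sub, coeff_C_mul,
      coeff_C_mul, hcP, coeff_natDegree] at hMc
    have : (c - k * (c - a) * (c - b)) * Q.leadingCoeff ^ 2 = 0 := by
      linear_combination hMc
    simpa [hlQ] using this
  have hriccati : derivative S * Q - S * derivative Q =
      S * (C (1 - k * (2 * c - a - b)) * Q - C k * S) := by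
    have hC := congrArg C hzero
    rw [← hM']
    rw [hS] at hK
    simp only [map_sub, map_mul, C_0, map_one, map_ofNat] at hC ⊢
    linear_combination -hK + Q ^ 2 * hC
  have hSd : derivative S = 0 := by
    rw [← dvd_derivative_iff]
    refine hScop.dvd_of_dvd_mul_right
      ⟨derivative Q + (C (1 - k * (2 * c - a - b)) * Q - C k * S), ?_⟩
    linear_combination hriccati
  obtain ⟨s, hs⟩ := natDegree_eq_zero.1 (derivative_eq_zero.1 hSd)
  subst hs
  have hs0 : s ≠ 0 := by
    rintro rfl
    rw [C_0, isCoprime_zero_left] at hScop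
    have := natDegree_eq_zero_of_isUnit hScop
    omega
  have hQ' : derivative Q = C (k * s) - C (1 - k * (2 * c - a - b)) * Q := by
    apply mul_left_cancel₀ (C_ne_zero.2 hs0)
    rw [derivative_C, zero_mul, zero_sub] at hriccati
    rw [C_mul]
    linear_combination -hriccati
  have hQ1 : Q.natDegree = 1 := by
    have hlt : (derivative Q).degree < Q.degree := degree_derivative_lt hQ
    have hr : 1 - k * (2 * c - a - b) = 0 := by
      have h1 := coeff_eq_zero_of_degree_lt
        (hlt.trans_eq (degree_eq_natDegree hQ))
      rw [hQ', coeff_sub, coeff_C_mul, coeff_C, if_neg (by omega), zero_sub, neg_eq_zero,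
        coeff_natDegree] at h1
      exact (mul_eq_zero.1 h1).resolve_right hlQ
    rw [hr, C_0, zero_mul, sub_zero] at hQ'
    have := natDegree_derivative Q
    rw [hQ', natDegree_C] at this
    omega
  refine not_sharesFiniteValue_of_linear hQ1 hs0 ha0 (c := c) ?_
  rwa [add_comm, ← hS]

theorem not_shares_zero {P Q : ℂ[X]} (hPQ : IsCoprime P Q) (hP : P ≠ 0) (hQ : Q ≠ 0)
    (hd : 1 ≤ max P.natDegree Q.natDegree) {v : ℂ} (hv : v ≠ 0)
    (h0 : SharesFiniteValue P Q 0) (h0' : SharesValueAtInfinity P Q 0)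
    (h : SharesFiniteValue P Q v) (h' : SharesValueAtInfinity P Q v) : False := by
  have hpq : P.natDegree ≠ Q.natDegree := fun he => by
    have hdeg : P.degree = Q.degree := by
      rw [degree_eq_natDegree hP, degree_eq_natDegree hQ, he]
    have hlt := degree_derivative_mul_sub_lt hP hQ
    rw [hdeg] at hlt
    simp only [SharesValueAtInfinity, C_0, zero_mul, sub_zero, hdeg, hlt, lt_irrefl] at h0'
    exact h0'.2 trivial
  have hdF := natDegree_sub_C_mul_of_shares hP hQ hv h'
  have hF : P - C v * Q ≠ 0 := fun h => by simp [h] at hdF; omega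
  have hMle := natDegree_add_le_of_natDegree_ne hP hQ hpq
  obtain ⟨A, A', G, hPA, hPA', hAA, hA⟩ := exists_radical_factorization hP
  obtain ⟨B, B', H, hQB, hQB', hBB, hB⟩ := exists_radical_factorization hQ
  have hfac : derivative P * Q - P * derivative Q = G * H * (A' * B - A * B') := by
    rw [hPA', hQB']
    conv_lhs => rw [hPA, hQB]
    ring
  have hPz : ∀ {z}, A.eval z = 0 → P.eval z = 0 := fun {z} hz => by simp [hPA, hz]
  have hQz : ∀ {z}, B.eval z = 0 → Q.eval z = 0 := fun {z} hz => by simp [hQB, hz]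
  have hK : ∀ z, (A' * B - A * B').eval z ≠ 0 := fun z hz => by
    by_cases hAz : A.eval z = 0
    · have h1 : A'.eval z * B.eval z = 0 := by simpa [hAz] using hz
      rcases mul_eq_zero.1 h1 with h1 | h1
      · exact eval_ne_zero_of_isCoprime hAA hAz h1
      · exact eval_ne_zero_of_isCoprime hPQ (hPz hAz) (hQz h1)
    by_cases hBz : B.eval z = 0
    · have h1 : A.eval z * B'.eval z = 0 := by simpa [hBz] using hz
      exact (mul_eq_zero.1 h1).elim hAz (eval_ne_zero_of_isCoprime hBB hBz)
    refine hAz (hA z ?_)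
    have := (h0 z (fun hq => hBz (hB z hq))).2 (by rw [hfac, eval_mul, hz]; ring)
    simpa using this
  have hK0 := natDegree_eq_zero_of_eval_ne_zero hK
  have hG : G ≠ 0 := left_ne_zero_of_mul (hPA ▸ hP)
  have hA0 : A ≠ 0 := right_ne_zero_of_mul (hPA ▸ hP)
  have hH : H ≠ 0 := left_ne_zero_of_mul (hQB ▸ hQ)
  have hB0 : B ≠ 0 := right_ne_zero_of_mul (hQB ▸ hQ)
  have hp : P.natDegree = G.natDegree + A.natDegree := by
    conv_lhs => rw [hPA, natDegree_mul hG hA0]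
  have hq : Q.natDegree = H.natDegree + B.natDegree := by
    conv_lhs => rw [hQB, natDegree_mul hH hB0]
  have hAB : A.natDegree + B.natDegree ≤ 1 := by
    have h1 : (G * H * (A' * B - A * B')).natDegree ≤ G.natDegree + H.natDegree := by
      refine natDegree_mul_le.trans ?_
      rw [hK0, natDegree_mul hG hH, add_zero]
    rw [hfac] at hMle
    omega
  have hdvd : P - C v * Q ∣ A * B - (A' * B - A * B') := by
    refine dvd_of_simple_roots hF (fun z => eval_derivative_ne_zero hPQ hv h) fun z hz => ?_
    have hQne := eval_denominator_ne_zero hPQ hz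
    have hPne : P.eval z ≠ 0 := eval_numerator_eq hz ▸ mul_ne_zero hv hQne
    have h1 := eval_sub_eq_zero hPQ h hz
    rw [hfac, show P * Q - G * H * (A' * B - A * B') =
      G * H * (A * B - (A' * B - A * B')) by
        conv_lhs => rw [hPA, hQB]
        ring, eval_mul, eval_mul] at h1
    refine (mul_eq_zero.1 h1).resolve_left (mul_ne_zero ?_ ?_)
    · rw [hPA, eval_mul] at hPne
      exact left_ne_zero_of_mul hPne
    · rw [hQB, eval_mul] at hQne
      exact left_ne_zero_of_mul hQne
  have hne : A * B - (A' * B - A * B') ≠ 0 := fun he => by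
    have hABne : ∀ z, (A * B).eval z ≠ 0 := fun z => by
      rw [sub_eq_zero.1 he]
      exact hK z
    have hp0 : P.natDegree = 0 := natDegree_eq_zero_of_eval_ne_zero fun z hz =>
      hABne z (by simp [hA z hz])
    have hq0 : Q.natDegree = 0 := natDegree_eq_zero_of_eval_ne_zero fun z hz =>
      hABne z (by simp [hB z hz])
    omega
  have hd1 : max P.natDegree Q.natDegree ≤ 1 := by
    rw [← hdF]
    refine (natDegree_le_of_dvd hdvd hne).trans ((natDegree_sub_le _ _).trans ?_)
    rw [hK0, natDegree_mul hA0 hB0]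
    omega
  rcases Nat.eq_zero_or_pos P.natDegree with hp0 | hp0
  · obtain ⟨s, rfl⟩ := natDegree_eq_zero.1 hp0
    refine not_sharesFiniteValue_of_linear (Q := Q) (c := 0) (by omega)
      (C_ne_zero.1 hP) hv ?_
    rwa [C_0, zero_mul, zero_add]
  · have hp1 : P.natDegree = 1 := by omega
    obtain ⟨t, rfl⟩ := natDegree_eq_zero.1 (show Q.natDegree = 0 by omega)
    obtain ⟨m, hm, n, rfl⟩ := natDegree_eq_one.1 hp1
    have ht : t ≠ 0 := C_ne_zero.1 hQ
    have h1 := (h0 (-n / m) (by simpa)).1 (by simp; field_simp; ring)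
    simp [hm, ht] at h1

/-- A non-constant rational function `R = P/Q` cannot share two distinct finite values
with its derivative on the sphere `ℂ∪{∞}`. -/
theorem rational_cannot_share_two_values_on_sphere
    (P Q : ℂ[X]) (hPQ : IsCoprime P Q) (hQ : Q ≠ 0)
    (hd : 1 ≤ max P.natDegree Q.natDegree)
    (a b : ℂ) (hab : a ≠ b) :
    ¬ (∀ v ∈ ({a, b} : Set ℂ),
        (∀ z : ℂ, Q.eval z ≠ 0 →
          (P.eval z = v * Q.eval z ↔
            (derivative P * Q - P * derivative Q).eval z = v * (Q.eval z) ^ 2)) ∧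
        ((P - C v * Q).degree < Q.degree ↔
          (derivative P * Q - P * derivative Q - C v * Q ^ 2).degree <
            Q.degree + Q.degree)) := by
  intro h
  obtain ⟨ha, ha'⟩ := h a (by simp)
  obtain ⟨hb, hb'⟩ := h b (by simp)
  have hP : P ≠ 0 := by
    rintro rfl
    rw [isCoprime_zero_left] at hPQ
    have := natDegree_eq_zero_of_isUnit hPQ
    simp only [natDegree_zero] at hd
    omega
  by_cases ha0 : a = 0
  · subst ha0
    exact not_shares_zero hPQ hP hQ hd hab.symm ha ha' hb hb'
  by_cases hb0 : b = 0
  · subst hb0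
    exact not_shares_zero hPQ hP hQ hd hab hb hb' ha ha'
  exact not_shares_of_ne_zero hPQ hP hQ hd hab ha0 hb0 ha ha' hb hb'
end

section
/- Let R = P/Q be a non-constant rational function, with P, Q ∈ ℂ[X] coprime, Q ≠ 0 and max(deg P, deg Q) ≥ 1, and let a, b ∈ ℂ with a ≠ b. Then R and R' cannot share both values a and b in ℂ; i.e., it is not the case that for each v ∈ {a, b} and every z ∈ ℂ with Q(z) ≠ 0 one has P(z) = v·Q(z) ⇔ P'(z)·Q(z) − P(z)·Q'(z) = v·Q(z)². -/
open Polynomial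

namespace SharedValues

variable {K : Type*} [Field K]

theorem isCoprime_of_eval_ne_zero [IsAlgClosed K] {p q : K[X]}
    (h : ∀ z, p.eval z = 0 → q.eval z ≠ 0) : IsCoprime p q := by
  refine (isCoprime_iff_aeval_ne_zero_of_isAlgClosed (k := K) K p q).mpr fun z => ?_
  simp only [coe_aeval_eq_eval]
  by_cases hz : p.eval z = 0
  · exact Or.inr (h z hz)
  · exact Or.inl hz

theorem eval_ne_zero_of_isCoprime {p q : K[X]} (h : IsCoprime p q) {z : K}
    (hz : p.eval z = 0) : q.eval z ≠ 0 := by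
  obtain ⟨u, v, huv⟩ := h
  intro hq
  simpa [hz, hq] using congrArg (eval z) huv

/-- `E` is the monic radical of `Q`, with cofactor `D`, and `F / E` is the logarithmic
derivative of `Q` in lowest terms. -/
structure IsLogDeriv (Q E D F : K[X]) : Prop where
  monic : E.Monic
  eq_mul : Q = E * D
  derivative_eq : derivative Q = D * F
  separable : E.Separable
  isCoprime : IsCoprime E F
  eval_eq_zero : ∀ z, Q.eval z = 0 → E.eval z = 0
  degree_lt : F.degree < E.degree
  natDegree_le : F.natDegree ≤ E.natDegree - 1
  coeff_eq : F.coeff (E.natDegree - 1) = Q.natDegree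

theorem exists_isLogDeriv [IsAlgClosed K] [CharZero K] {Q : K[X]} (hQ : Q ≠ 0) :
    ∃ E D F, IsLogDeriv Q E D F := by
  classical
  obtain ⟨E, D, F, hE, hQE, hQ', hsq, hroot⟩ : ∃ E D F : K[X], E.Monic ∧ Q = E * D ∧
      derivative Q = D * F ∧ Squarefree E ∧ ∀ z, Q.eval z = 0 → E.eval z = 0 := by
    set r := UniqueFactorizationMonoid.radical Q with hr
    have hr0 : r ≠ 0 := UniqueFactorizationMonoid.radical_ne_zero
    have hlc : r.leadingCoeff ≠ 0 := leadingCoeff_ne_zero.mpr hr0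
    have hC : C r.leadingCoeff * C r.leadingCoeff⁻¹ = (1 : K[X]) := by
      rw [← C_mul, mul_inv_cancel₀ hlc, C_1]
    obtain ⟨G, hG⟩ := divRadical_dvd_derivative Q
    have hmul : r * EuclideanDomain.divRadical Q = Q := EuclideanDomain.radical_mul_divRadical
    refine ⟨r * C r.leadingCoeff⁻¹, C r.leadingCoeff * EuclideanDomain.divRadical Q,
      C r.leadingCoeff⁻¹ * G, monic_mul_leadingCoeff_inv hr0, ?_, ?_, ?_, ?_⟩
    · linear_combination -hmul - r * EuclideanDomain.divRadical Q * hC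
    · linear_combination hG - EuclideanDomain.divRadical Q * G * hC
    · refine UniqueFactorizationMonoid.squarefree_radical.squarefree_of_dvd (y := r) ?_
      exact ⟨C r.leadingCoeff, by linear_combination -r * hC⟩
    · intro z hz
      obtain ⟨n, hn⟩ := UniqueFactorizationMonoid.exists_dvd_radical_self_pow hQ
      have := (eval_pow (p := r) (x := z) n).symm.trans
        (eval_eq_zero_of_dvd_of_eval_eq_zero hn hz)
      simp [eq_zero_of_pow_eq_zero this]
  have hsep : E.Separable := PerfectField.separable_iff_squarefree.mpr hsq
  have hE0 : E ≠ 0 := hE.ne_zero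
  have hD0 : D ≠ 0 := by rintro rfl; simp [hQE] at hQ
  have hkey : derivative Q * E = Q * F := by rw [hQE] at hQ' ⊢; linear_combination E * hQ'
  have hcop : IsCoprime E F := by
    refine isCoprime_of_eval_ne_zero fun z hz hFz => ?_
    have hQz : Q.IsRoot z := by simp [hQE, hz]
    have hQ'0 : derivative Q ≠ 0 := by
      intro h0
      rw [eq_C_of_derivative_eq_zero h0] at hQz hQ
      simp only [IsRoot.def, eval_C] at hQz
      simp [hQz] at hQ
    have hF0 : F ≠ 0 := by rintro rfl; simp at hQ'; exact hQ'0 (by simpa using hQ')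
    have h1 := derivative_rootMultiplicity_of_root hQz
    have h2 := congrArg (rootMultiplicity z) hQ'
    have h3 := congrArg (rootMultiplicity z) hQE
    rw [rootMultiplicity_mul (mul_ne_zero hD0 hF0)] at h2
    rw [rootMultiplicity_mul (mul_ne_zero hE0 hD0)] at h3
    have h4 : rootMultiplicity z E ≤ 1 := rootMultiplicity_le_one_of_separable hsep z
    have h5 := (rootMultiplicity_pos hF0).mpr hFz
    have h6 := (rootMultiplicity_pos hE0).mpr hz
    omega
  by_cases hq : Q.natDegree = 0
  · have hQ'0 : derivative Q = 0 := by rw [eq_C_of_natDegree_eq_zero hq, derivative_C]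
    have hF0 : F = 0 := by
      rw [hQ'0] at hQ'
      exact (mul_eq_zero.mp hQ'.symm).resolve_left hD0
    refine ⟨E, D, F, hE, hQE, hQ', hsep, hcop, hroot, ?_, ?_, ?_⟩
    · rw [hF0, degree_zero]; exact bot_lt_iff_ne_bot.mpr (degree_ne_bot.mpr hE0)
    · simp [hF0]
    · simp [hF0, hq]
  · have hQ'deg : (derivative Q).natDegree = Q.natDegree - 1 := natDegree_derivative Q
    have hQ'0 : derivative Q ≠ 0 := derivative_ne_zero.mpr hq
    have hF0 : F ≠ 0 := by rintro rfl; simp at hQ'; exact hQ'0 (by simpa using hQ')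
    have hdeg := congrArg natDegree hkey
    rw [natDegree_mul hQ'0 hE0, natDegree_mul hQ hF0] at hdeg
    have hFdeg : F.natDegree = E.natDegree - 1 := by omega
    have hlc := congrArg leadingCoeff hkey
    rw [leadingCoeff_mul, leadingCoeff_mul, hE.leadingCoeff, mul_one,
      leadingCoeff_derivative] at hlc
    refine ⟨E, D, F, hE, hQE, hQ', hsep, hcop, hroot, ?_, hFdeg.le, ?_⟩
    · exact degree_lt_degree (by omega)
    · rw [← hFdeg]
      refine mul_left_cancel₀ (leadingCoeff_ne_zero.mpr hQ) ?_
      simpa [mul_comm] using hlc.symm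

namespace IsLogDeriv

variable {Q E D F : K[X]}

theorem derivative_mul_eq (h : IsLogDeriv Q E D F) : derivative Q * E = Q * F := by
  linear_combination E * h.derivative_eq - F * h.eq_mul

theorem ne_zero_of_eval_ne_zero (h : IsLogDeriv Q E D F) {z : K} (hz : E.eval z ≠ 0) :
    Q.eval z ≠ 0 :=
  mt (h.eval_eq_zero z) hz

theorem eval_eq_zero_of_eval_eq_zero (h : IsLogDeriv Q E D F) {z : K} (hz : E.eval z = 0) :
    Q.eval z = 0 := by
  simp [h.eq_mul, hz]

theorem eq_one_and_eq_zero (h : IsLogDeriv Q E D F) (hE : E.natDegree = 0) : E = 1 ∧ F = 0 := by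
  have hE1 : E = 1 := h.monic.natDegree_eq_zero.mp hE
  have hF := h.degree_lt
  rw [hE1, degree_one] at hF
  exact ⟨hE1, degree_eq_bot.mp (Nat.WithBot.lt_zero_iff.mp hF)⟩

theorem dvd_mul_sub_derivative (h : IsLogDeriv Q E D F) : E ∣ D * (F - derivative E) := by
  have h1 := h.derivative_eq
  have h2 := congrArg derivative h.eq_mul
  rw [derivative_mul] at h2
  exact ⟨derivative D, by linear_combination h2 - h1⟩

theorem natDegree_le_natDegree (h : IsLogDeriv Q E D F) (hQ : Q ≠ 0) : E.natDegree ≤ Q.natDegree :=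
  natDegree_le_of_dvd ⟨D, h.eq_mul⟩ hQ

theorem one_le_natDegree [IsAlgClosed K] (h : IsLogDeriv Q E D F) (hQ : 1 ≤ Q.natDegree) :
    1 ≤ E.natDegree := by
  have hQ0 : Q.degree ≠ 0 := by
    rw [degree_eq_natDegree (by rintro rfl; simp at hQ)]
    exact_mod_cast (by omega : Q.natDegree ≠ 0)
  obtain ⟨z, hz⟩ := IsAlgClosed.exists_root Q hQ0
  rw [Nat.one_le_iff_ne_zero]
  intro h0
  have hE := h.eval_eq_zero z hz
  rw [h.monic.natDegree_eq_zero.mp h0] at hE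
  simp at hE

theorem isCoprime_right {P S : K[X]} (h : IsLogDeriv Q E D F) (hPQ : IsCoprime P Q)
    (hS : S = derivative P * E - P * F) : IsCoprime E S := by
  have hEP : IsCoprime E P := (hPQ.of_isCoprime_of_dvd_right ⟨D, h.eq_mul⟩).symm
  have : IsCoprime E (-(P * F) + E * derivative P) :=
    ((hEP.mul_right h.isCoprime).neg_right).add_mul_left_right _
  rwa [show S = -(P * F) + E * derivative P by rw [hS]; ring]

end IsLogDeriv

theorem dvd_derivative_mul_of_forall_eval [IsAlgClosed K] [CharZero K] {A G : K[X]}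
    (h : ∀ z, A.eval z = 0 → G.eval z = 0) : A ∣ derivative A * G := by
  by_cases hA : A = 0
  · have : G = 0 := Polynomial.funext fun z => by simpa using h z (by simp [hA])
    simp [this]
  · exact (isRoot_of_isRoot_iff_dvd_derivative_mul hA).mp h

theorem natDegree_derivative_mul_le {p q : K[X]} {m n : ℕ} (hp : p.natDegree ≤ m)
    (hq : q.natDegree ≤ n + 1) : (derivative p * q).natDegree ≤ m + n := by
  rcases m with _ | m
  · simp [derivative_of_natDegree_zero (Nat.le_zero.mp hp)]
  · have := natDegree_mul_le_of_le
      ((natDegree_derivative_le p).trans (Nat.sub_le_sub_right hp 1)) hq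
    omega

theorem coeff_derivative_mul {p q : K[X]} {m n : ℕ} (hp : p.natDegree ≤ m)
    (hq : q.natDegree ≤ n + 1) :
    (derivative p * q).coeff (m + n) = m * p.coeff m * q.coeff (n + 1) := by
  rcases m with _ | m
  · simp [derivative_of_natDegree_zero (Nat.le_zero.mp hp)]
  · have := coeff_mul_add_eq_of_natDegree_le
      ((natDegree_derivative_le p).trans (Nat.sub_le_sub_right hp 1)) hq
    rw [show m + 1 + n = m + 1 - 1 + (n + 1) by omega, this, coeff_derivative]
    simp only [Nat.add_sub_cancel, Nat.cast_add, Nat.cast_one]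
    ring

variable {P Q E D F S : K[X]}

/-- The value `v` is shared by `P / Q` and its derivative `S / (Q * E)`. -/
def SharesValue (P Q E S : K[X]) (v : K) : Prop :=
  ∀ z, (P - C v * Q).eval z = 0 ↔ (S - C v * (Q * E)).eval z = 0

theorem sharesValue_of_forall (h : IsLogDeriv Q E D F) (hPQ : IsCoprime P Q)
    (hS : S = derivative P * E - P * F) {v : K}
    (hv : ∀ z, Q.eval z ≠ 0 → (P.eval z = v * Q.eval z ↔
      (derivative P * Q - P * derivative Q).eval z = v * (Q.eval z) ^ 2)) :
    SharesValue P Q E S v := by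
  intro z
  by_cases hz : E.eval z = 0
  · have hQz := h.eval_eq_zero_of_eval_eq_zero hz
    have hPz := eval_ne_zero_of_isCoprime hPQ.symm hQz
    have hSz := eval_ne_zero_of_isCoprime (h.isCoprime_right hPQ hS) hz
    simp [hQz, hPz, hSz]
  · have hQz := h.ne_zero_of_eval_ne_zero hz
    have hDz : D.eval z ≠ 0 := fun h0 => hQz (by simp [h.eq_mul, h0])
    have hQeq : Q.eval z = E.eval z * D.eval z := by rw [← eval_mul, ← h.eq_mul]
    have key : (derivative P * Q - P * derivative Q).eval z - v * (Q.eval z) ^ 2 =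
        D.eval z * (S - C v * (Q * E)).eval z := by
      rw [h.derivative_eq, hS]
      simp only [eval_sub, eval_mul, eval_C, hQeq]
      ring
    have hmul : (S - C v * (Q * E)).eval z = 0 ↔ D.eval z * (S - C v * (Q * E)).eval z = 0 := by
      simp [hDz]
    rw [hmul, ← key, sub_eq_zero, ← hv z hQz]
    simp [sub_eq_zero]

/-- The numerator of the difference between a rational function and its derivative vanishes
at every shared value. -/
theorem SharesValue.eval_eq_zero {v : K} (hv : SharesValue P Q E S v) {z : K}
    (hz : (P - C v * Q).eval z = 0) : (P * E - S).eval z = 0 := by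
  have h1 := (hv z).mp hz
  simp only [eval_sub, eval_mul, eval_C] at hz h1 ⊢
  linear_combination E.eval z * hz - h1

theorem isCoprime_sub_sub [IsAlgClosed K] (hPQ : IsCoprime P Q) {v w : K} (hvw : v ≠ w) :
    IsCoprime (P - C v * Q) (P - C w * Q) := by
  refine isCoprime_of_eval_ne_zero fun z h1 h2 => ?_
  simp only [eval_sub, eval_mul, eval_C] at h1 h2
  have hQz : Q.eval z = 0 := by
    refine (mul_eq_zero.mp (?_ : (v - w) * Q.eval z = 0)).resolve_left (sub_ne_zero.mpr hvw)
    linear_combination h2 - h1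
  exact eval_ne_zero_of_isCoprime hPQ.symm hQz (by simpa [hQz] using h1)

/-- The function `H / E` of `exists_mul_eq_mul` is determined by its poles as soon as it
vanishes at infinity. -/
theorem eq_add_derivative_of_dvd (h : IsLogDeriv Q E D F) {H : K[X]}
    (hdvd : E ∣ H - (F + derivative E)) (hH : H.degree < E.degree) :
    H = F + derivative E := by
  have hE' : (derivative E).degree < E.degree := degree_derivative_lt h.monic.ne_zero
  refine sub_eq_zero.mp (eq_zero_of_dvd_of_degree_lt hdvd ?_)
  exact (degree_sub_le _ _).trans_lt
    (max_lt hH ((degree_add_le _ _).trans_lt (max_lt h.degree_lt hE')))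

theorem natDegree_numerator_le (h : IsLogDeriv Q E D F) (hS : S = derivative P * E - P * F)
    {p k : ℕ} (hk : E.natDegree = k + 1) (hp : P.natDegree ≤ p) : S.natDegree ≤ p + k := by
  have hF : F.natDegree ≤ k := by simpa [hk] using h.natDegree_le
  rw [hS]
  exact (natDegree_sub_le_of_le (natDegree_derivative_mul_le hp hk.le)
    (natDegree_mul_le_of_le hp hF)).trans (max_self _).le

theorem natDegree_add_derivative_le (h : IsLogDeriv Q E D F) {k : ℕ}
    (hk : E.natDegree = k + 1) : (F + derivative E).natDegree ≤ k := by
  have hF : F.natDegree ≤ k := by simpa [hk] using h.natDegree_le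
  have hE : (derivative E).natDegree ≤ k := by simpa [hk] using natDegree_derivative_le E
  exact (natDegree_add_le_of_le hF hE).trans (max_self _).le

theorem coeff_add_derivative (h : IsLogDeriv Q E D F) {k : ℕ} (hk : E.natDegree = k + 1) :
    (F + derivative E).coeff k = Q.natDegree + (k + 1) := by
  have hF : F.coeff k = Q.natDegree := by simpa [hk] using h.coeff_eq
  have hE : E.coeff (k + 1) = 1 := by rw [← hk]; exact h.monic.coeff_natDegree
  rw [coeff_add, hF, coeff_derivative, hE, one_mul]

theorem natDegree_second_numerator_le (h : IsLogDeriv Q E D F) {s k : ℕ}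
    (hk : E.natDegree = k + 1) (hs : S.natDegree ≤ s) :
    (derivative S * E - S * (F + derivative E)).natDegree ≤ s + k :=
  (natDegree_sub_le_of_le (natDegree_derivative_mul_le hs hk.le)
    (natDegree_mul_le_of_le hs (natDegree_add_derivative_le h hk))).trans (max_self _).le

theorem coeff_second_numerator (h : IsLogDeriv Q E D F) {s k : ℕ}
    (hk : E.natDegree = k + 1) (hs : S.natDegree ≤ s) :
    (derivative S * E - S * (F + derivative E)).coeff (s + k) =
      (s - (Q.natDegree + (k + 1))) * S.coeff s := by
  have hE : E.coeff (k + 1) = 1 := by rw [← hk]; exact h.monic.coeff_natDegree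
  rw [coeff_sub, coeff_derivative_mul hs hk.le,
    coeff_mul_add_eq_of_natDegree_le hs (natDegree_add_derivative_le h hk),
    coeff_add_derivative h hk, hE]
  ring

theorem natDegree_mul_sub_numerator (h : IsLogDeriv Q E D F) (hS : S = derivative P * E - P * F)
    (hP : P ≠ 0) (hd : Q.natDegree < P.natDegree) :
    (P * E - S).natDegree = P.natDegree + E.natDegree := by
  have hPE : (P * E).natDegree = P.natDegree + E.natDegree := natDegree_mul hP h.monic.ne_zero
  have hlt : S.natDegree < P.natDegree + E.natDegree := by
    rcases hk : E.natDegree with _ | k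
    · obtain ⟨hE, hF⟩ := h.eq_one_and_eq_zero hk
      rw [hS, hE, hF, mul_one, mul_zero, sub_zero]
      exact natDegree_derivative_lt (by omega)
    · have := natDegree_numerator_le h hS hk le_rfl
      omega
  rw [natDegree_sub_eq_left_of_natDegree_lt (by omega), hPE]

theorem natDegree_mul_sub_le {p k : ℕ} (hk : E.natDegree = k + 1) (hp : P.natDegree ≤ p)
    (hs : S.natDegree ≤ p + k) : (P * E - S).natDegree ≤ p + (k + 1) :=
  (natDegree_sub_le_of_le (natDegree_mul_le_of_le hp hk.le) hs).trans (by simp)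

theorem coeff_mul_sub (hE : E.Monic) {p k : ℕ} (hk : E.natDegree = k + 1)
    (hp : P.natDegree ≤ p) (hs : S.natDegree ≤ p + k) :
    (P * E - S).coeff (p + (k + 1)) = P.coeff p := by
  have hE : E.coeff (k + 1) = 1 := by rw [← hk]; exact hE.coeff_natDegree
  rw [coeff_sub, coeff_mul_add_eq_of_natDegree_le hp hk.le,
    coeff_eq_zero_of_natDegree_lt (show S.natDegree < p + (k + 1) by omega), hE]
  ring

theorem natDegree_sub_C_mul_mul (hE : E.Monic) (hQ : Q ≠ 0) {k : ℕ}
    (hk : E.natDegree = k + 1) (hs : S.natDegree ≤ Q.natDegree + k) {v : K} (hv : v ≠ 0) :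
    (S - C v * (Q * E)).natDegree = Q.natDegree + (k + 1) := by
  have h1 : (C v * (Q * E)).natDegree = Q.natDegree + (k + 1) := by
    rw [natDegree_C_mul hv, natDegree_mul hQ hE.ne_zero, hk]
  rw [natDegree_sub_eq_right_of_natDegree_lt (by omega), h1]

variable [IsAlgClosed K]

/-- If `R = P / Q` shares the value zero with its derivative, then every zero of `R` is
multiple, and the numerator of `R'` is up to a constant the cofactor of the radical of `P`. -/
theorem SharesValue.exists_eq_mul_C {N M L : K[X]} (h : IsLogDeriv Q E D F)
    (hP : IsLogDeriv P N M L) (hPQ : IsCoprime P Q) (hS : S = derivative P * E - P * F)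
    (h0 : SharesValue P Q E S 0) :
    ∃ c, c ≠ 0 ∧ S = M * C c ∧ L * E - N * F = C c := by
  have hSM : S = M * (L * E - N * F) := by
    rw [hS]
    linear_combination E * hP.derivative_eq - F * hP.eq_mul
  have hroot : ∀ z, (L * E - N * F).eval z ≠ 0 := by
    intro z hz
    have hPz : P.eval z = 0 := by simpa using (h0 z).mpr (by rw [hSM]; simp [hz])
    have hNz := hP.eval_eq_zero z hPz
    have hEz : E.eval z ≠ 0 := fun hE =>
      eval_ne_zero_of_isCoprime hPQ hPz (h.eval_eq_zero_of_eval_eq_zero hE)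
    have hLz := eval_ne_zero_of_isCoprime hP.isCoprime hNz
    simp [hNz, hEz, hLz] at hz
  have hdeg : (L * E - N * F).degree = 0 := by
    by_contra hne
    obtain ⟨z, hz⟩ := IsAlgClosed.exists_root _ hne
    exact hroot z hz
  obtain ⟨c, hc⟩ : ∃ c, L * E - N * F = C c := ⟨_, eq_C_of_degree_eq_zero hdeg⟩
  refine ⟨c, ?_, hSM.trans (by rw [hc]), hc⟩
  rintro rfl
  rw [hc] at hroot
  simpa using hroot 0

theorem SharesValue.natDegree_radical_lt {N M L : K[X]} (h : IsLogDeriv Q E D F)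
    (hP : IsLogDeriv P N M L) (hPQ : IsCoprime P Q) (hS : S = derivative P * E - P * F)
    (h0 : SharesValue P Q E S 0) (hd : 1 ≤ P.natDegree) :
    1 ≤ M.natDegree ∧ P.natDegree = N.natDegree + M.natDegree := by
  have hP0 : P ≠ 0 := by rintro rfl; simp at hd
  have hM0 : M ≠ 0 := by rintro rfl; exact hP0 (by simpa using hP.eq_mul)
  have hN := hP.one_le_natDegree hd
  obtain ⟨z, hz⟩ := IsAlgClosed.exists_root N (by
    rw [degree_eq_natDegree hP.monic.ne_zero]
    exact_mod_cast (by omega : N.natDegree ≠ 0))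
  refine ⟨?_, by rw [← natDegree_mul hP.monic.ne_zero hM0, ← hP.eq_mul]⟩
  have hPz := hP.eval_eq_zero_of_eval_eq_zero hz
  have hEz : E.eval z ≠ 0 := fun hE =>
    eval_ne_zero_of_isCoprime hPQ hPz (h.eval_eq_zero_of_eval_eq_zero hE)
  have hLz := eval_ne_zero_of_isCoprime hP.isCoprime hz
  have hSz : S.eval z = 0 := by simpa using (h0 z).mp (by simpa using hPz)
  rw [hS, hP.derivative_eq] at hSz
  have hMz : M.eval z = 0 := by simpa [hPz, hEz, hLz] using hSz
  rw [Nat.one_le_iff_ne_zero]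
  intro hM
  rw [eq_C_of_natDegree_eq_zero hM] at hMz hM0
  rw [eval_C] at hMz
  simp [hMz] at hM0

variable [CharZero K]

theorem SharesValue.sub_dvd (h : IsLogDeriv Q E D F) (hPQ : IsCoprime P Q)
    (hS : S = derivative P * E - P * F) {v : K} (hv0 : v ≠ 0)
    (hv : SharesValue P Q E S v) : P - C v * Q ∣ P * E - S := by
  have hcop : IsCoprime (P - C v * Q) (derivative (P - C v * Q)) := by
    refine isCoprime_of_eval_ne_zero fun z hz hz' => ?_
    have hSz := (hv z).mp hz
    have hkey := congrArg (eval z) h.derivative_mul_eq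
    have hEz : E.eval z ≠ 0 := by
      intro hEz
      have hQz := h.eval_eq_zero_of_eval_eq_zero hEz
      exact eval_ne_zero_of_isCoprime hPQ.symm hQz (by simpa [hQz] using hz)
    refine mul_ne_zero (mul_ne_zero hv0 (h.ne_zero_of_eval_ne_zero hEz)) hEz ?_
    rw [hS] at hSz
    simp only [eval_sub, eval_mul, eval_C, derivative_sub, derivative_C_mul] at *
    linear_combination E.eval z * hz' - F.eval z * hz - hSz + v * hkey
  exact hcop.dvd_of_dvd_mul_left (dvd_derivative_mul_of_forall_eval fun z => hv.eval_eq_zero)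

/-- If `R = P / Q` and its derivative share the values `v` and `w`, then
`R'' (R - R') / ((R' - v) (R' - w)) = H / E` has at most simple poles, and its residues are
those of `(Q * E)' / (Q * E)`. -/
theorem exists_mul_eq_mul (h : IsLogDeriv Q E D F) (hPQ : IsCoprime P Q)
    (hS : S = derivative P * E - P * F) {v w : K} (hvw : v ≠ w)
    (hv : SharesValue P Q E S v) (hw : SharesValue P Q E S w) :
    ∃ H, (S - C v * (Q * E)) * (S - C w * (Q * E)) * H =
        (derivative S * E - S * (F + derivative E)) * (P * E - S) ∧
      E ∣ H - (F + derivative E) := by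
  have hES := h.isCoprime_right hPQ hS
  have hdvd {u : K} (hu : SharesValue P Q E S u) : S - C u * (Q * E) ∣
      (derivative S * E - S * (F + derivative E)) * (P * E - S) := by
    have h1 : S - C u * (Q * E) ∣ derivative (S - C u * (Q * E)) * (P * E - S) :=
      dvd_derivative_mul_of_forall_eval fun z hz => hu.eval_eq_zero ((hu z).mpr hz)
    have h2 : (derivative S * E - S * (F + derivative E)) * (P * E - S) =
        derivative (S - C u * (Q * E)) * (P * E - S) * E -
          (S - C u * (Q * E)) * ((F + derivative E) * (P * E - S)) := by
      simp only [derivative_sub, derivative_mul, derivative_C]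
      linear_combination C u * E * (P * E - S) * h.derivative_mul_eq
    rw [h2]
    exact dvd_sub (h1.mul_right _) (dvd_mul_right _ _)
  have hcop : IsCoprime (S - C v * (Q * E)) (S - C w * (Q * E)) := by
    have hSQ : IsCoprime S (Q * E) := by
      refine (isCoprime_of_eval_ne_zero fun z hz => ?_ : IsCoprime (Q * E) S).symm
      refine eval_ne_zero_of_isCoprime hES ?_
      rw [eval_mul, mul_eq_zero] at hz
      exact hz.elim (h.eval_eq_zero z) id
    exact isCoprime_sub_sub hSQ hvw
  obtain ⟨H, hH⟩ := hcop.mul_dvd (hdvd hv) (hdvd hw)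
  refine ⟨H, hH.symm, ?_⟩
  have : E ∣ (S * S) * (H - (F + derivative E)) := by
    refine ⟨derivative S * P * E - derivative S * S - S * (F + derivative E) * P +
      (C v + C w) * Q * S * H - C v * C w * Q ^ 2 * E * H, ?_⟩
    linear_combination -hH
  exact (hES.mul_right hES).dvd_of_dvd_mul_left this

theorem not_sharesValue_of_natDegree_le (h : IsLogDeriv Q E D F) (hPQ : IsCoprime P Q)
    (hS : S = derivative P * E - P * F) (hd : P.natDegree ≤ Q.natDegree)
    (hq : 1 ≤ Q.natDegree) {v w : K} (hvw : v ≠ w) (hv0 : v ≠ 0) (hw0 : w ≠ 0)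
    (hv : SharesValue P Q E S v) (hw : SharesValue P Q E S w) : False := by
  have hQ0 : Q ≠ 0 := by rintro rfl; simp at hq
  obtain ⟨k, hk⟩ := Nat.exists_eq_add_of_le' (h.one_le_natDegree hq)
  obtain ⟨H, hH, hdvd⟩ := exists_mul_eq_mul h hPQ hS hvw hv hw
  have hs := natDegree_numerator_le h hS hk hd
  have hdeg := (congrArg natDegree hH).le.trans (natDegree_mul_le_of_le
    (natDegree_second_numerator_le h hk hs) (natDegree_mul_sub_le hk hd hs))
  have hv1 := natDegree_sub_C_mul_mul h.monic hQ0 hk hs hv0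
  have hw1 := natDegree_sub_C_mul_mul h.monic hQ0 hk hs hw0
  have hv2 : S - C v * (Q * E) ≠ 0 := fun h0 => by rw [h0, natDegree_zero] at hv1; omega
  have hw2 : S - C w * (Q * E) ≠ 0 := fun h0 => by rw [h0, natDegree_zero] at hw1; omega
  have hH' : H.coeff k = 0 ∧ H.degree < E.degree := by
    by_cases hH0 : H = 0
    · rw [hH0, degree_zero]
      exact ⟨coeff_zero _, bot_lt_iff_ne_bot.mpr (degree_ne_bot.mpr h.monic.ne_zero)⟩
    · rw [natDegree_mul (mul_ne_zero hv2 hw2) hH0, natDegree_mul hv2 hw2, hv1, hw1] at hdeg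
      exact ⟨coeff_eq_zero_of_natDegree_lt (by omega), degree_lt_degree (by omega)⟩
  have hcoeff := coeff_add_derivative h hk
  rw [← eq_add_derivative_of_dvd h hdvd hH'.2, hH'.1] at hcoeff
  exact absurd hcoeff.symm (by exact_mod_cast (by omega : Q.natDegree + (k + 1) ≠ 0))

theorem not_sharesValue_of_natDegree_lt (h : IsLogDeriv Q E D F) (hPQ : IsCoprime P Q)
    (hQ : Q ≠ 0) (hS : S = derivative P * E - P * F) (hd : Q.natDegree < P.natDegree)
    {v w : K} (hvw : v ≠ w) (hv0 : v ≠ 0) (hw0 : w ≠ 0)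
    (hv : SharesValue P Q E S v) (hw : SharesValue P Q E S w) : False := by
  have hP0 : P ≠ 0 := by rintro rfl; simp at hd
  have hdeg {u : K} (hu : u ≠ 0) : (P - C u * Q).natDegree = P.natDegree :=
    natDegree_sub_eq_left_of_natDegree_lt (by rwa [natDegree_C_mul hu])
  have hne {u : K} (hu : u ≠ 0) : P - C u * Q ≠ 0 := fun h0 => by
    have := hdeg hu
    rw [h0, natDegree_zero] at this
    omega
  have hdvd := (isCoprime_sub_sub hPQ hvw).mul_dvd (hv.sub_dvd h hPQ hS hv0)
    (hw.sub_dvd h hPQ hS hw0)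
  have hG := natDegree_mul_sub_numerator h hS hP0 hd
  have hle := natDegree_le_of_dvd hdvd (fun h0 => by rw [h0, natDegree_zero] at hG; omega)
  rw [natDegree_mul (hne hv0) (hne hw0), hdeg hv0, hdeg hw0, hG] at hle
  have := h.natDegree_le_natDegree hQ
  omega

theorem not_sharesValue_zero_of_natDegree_lt (h : IsLogDeriv Q E D F) (hPQ : IsCoprime P Q)
    (hS : S = derivative P * E - P * F) (hd : Q.natDegree < P.natDegree)
    {v : K} (hv0 : v ≠ 0) (hv : SharesValue P Q E S v) (h0 : SharesValue P Q E S 0) :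
    False := by
  have hP0 : P ≠ 0 := by rintro rfl; simp at hd
  obtain ⟨N, M, L, hP⟩ := exists_isLogDeriv hP0
  obtain ⟨c, hc, hSM, hW⟩ := h0.exists_eq_mul_C h hP hPQ hS
  obtain ⟨hM, hNM⟩ := h0.natDegree_radical_lt h hP hPQ hS (by omega)
  obtain ⟨n, hn⟩ := Nat.exists_eq_add_of_le' (hP.one_le_natDegree (by omega))
  have hL : L.natDegree ≤ n := by simpa [hn] using hP.natDegree_le
  have hLc : L.coeff n = P.natDegree := by simpa [hn] using hP.coeff_eq
  have hNc : N.coeff (n + 1) = 1 := by rw [← hn]; exact hP.monic.coeff_natDegree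
  have hnE : n + E.natDegree = 0 := by
    by_contra hne
    have h1 : (L * E).coeff (n + E.natDegree) = P.natDegree := by
      rw [coeff_mul_add_eq_of_natDegree_le hL le_rfl, hLc, h.monic.coeff_natDegree, mul_one]
    have h2 : (N * F).coeff (n + E.natDegree) = Q.natDegree := by
      rcases hk : E.natDegree with _ | k
      · have hF : F = 0 := (h.eq_one_and_eq_zero hk).2
        have := h.coeff_eq
        rw [hF, coeff_zero] at this
        rw [hF, mul_zero, coeff_zero, this]
      · have hF : F.natDegree ≤ k := by simpa [hk] using h.natDegree_le
        have hFc : F.coeff k = Q.natDegree := by simpa [hk] using h.coeff_eq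
        rw [show n + (k + 1) = n + 1 + k by ring, coeff_mul_add_eq_of_natDegree_le hn.le hF,
          hNc, hFc, one_mul]
    have h3 := congrArg (fun p => p.coeff (n + E.natDegree)) hW
    simp only [coeff_sub, h1, h2, coeff_C, hne, if_false] at h3
    have : P.natDegree = Q.natDegree := by exact_mod_cast sub_eq_zero.mp h3
    omega
  have hdvd := hv.sub_dvd h hPQ hS hv0
  have hG : P * E - S = M * (N * E - C c) := by rw [hSM]; linear_combination E * hP.eq_mul
  have hcop : IsCoprime (P - C v * Q) M := by
    have : IsCoprime P (P - C v * Q) := by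
      have := (isCoprime_sub_sub hPQ hv0).symm
      simpa using this
    exact (this.of_isCoprime_of_dvd_left ⟨N, by rw [mul_comm]; exact hP.eq_mul⟩).symm
  rw [hG] at hdvd
  have hdeg : (P - C v * Q).natDegree = P.natDegree :=
    natDegree_sub_eq_left_of_natDegree_lt (by rwa [natDegree_C_mul hv0])
  have hE : E = 1 := h.monic.natDegree_eq_zero.mp (by omega)
  have hNE : (N * E - C c).natDegree = 1 := by rw [hE, mul_one, natDegree_sub_C]; omega
  have hle := natDegree_le_of_dvd (hcop.dvd_of_dvd_mul_left hdvd)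
    (fun h0 => by rw [h0, natDegree_zero] at hNE; omega)
  omega

/-- If a rational function `P / Q` without pole at infinity shares the values zero and `v ≠ 0`
with its derivative, then the polynomial `H` of `exists_mul_eq_mul` is `F + derivative E`, and
comparing coefficients determines the value of `P / Q` at infinity. -/
theorem eq_add_derivative_and_coeff_eq (h : IsLogDeriv Q E D F) (hPQ : IsCoprime P Q)
    (hS : S = derivative P * E - P * F) (hS0 : S ≠ 0) (hd : P.natDegree ≤ Q.natDegree)
    (hQ : Q ≠ 0) {k : ℕ} (hk : E.natDegree = k + 1) {v : K} (hv0 : v ≠ 0)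
    (hv : SharesValue P Q E S v) (h0 : SharesValue P Q E S 0) :
    (S - C v * (Q * E)) * S * (F + derivative E) =
        (derivative S * E - S * (F + derivative E)) * (P * E - S) ∧
      v * Q.leadingCoeff * (Q.natDegree + (k + 1)) =
        (Q.natDegree + (k + 1) - S.natDegree) * P.coeff Q.natDegree := by
  obtain ⟨H, hH, hdvd⟩ := exists_mul_eq_mul h hPQ hS hv0 hv h0
  rw [C_0, zero_mul, sub_zero] at hH
  have hs := natDegree_numerator_le h hS hk hd
  have hU := natDegree_second_numerator_le h hk (le_refl S.natDegree)
  have hG := natDegree_mul_sub_le hk hd hs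
  have hA := natDegree_sub_C_mul_mul h.monic hQ hk hs hv0
  have hA0 : S - C v * (Q * E) ≠ 0 := fun h0 => by rw [h0, natDegree_zero] at hA; omega
  have hHdeg : H.degree < E.degree := by
    by_cases hH0 : H = 0
    · rw [hH0, degree_zero]
      exact bot_lt_iff_ne_bot.mpr (degree_ne_bot.mpr h.monic.ne_zero)
    · have hdeg := (congrArg natDegree hH).le.trans (natDegree_mul_le_of_le hU hG)
      rw [natDegree_mul (mul_ne_zero hA0 hS0) hH0, natDegree_mul hA0 hS0, hA] at hdeg
      exact degree_lt_degree (by omega)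
  have hHeq := eq_add_derivative_of_dvd h hdvd hHdeg
  rw [hHeq] at hH
  refine ⟨hH, ?_⟩
  have hAc : (S - C v * (Q * E)).coeff (Q.natDegree + (k + 1)) = -(v * Q.leadingCoeff) := by
    have hE : E.coeff (k + 1) = 1 := by rw [← hk]; exact h.monic.coeff_natDegree
    rw [coeff_sub, coeff_C_mul, coeff_mul_add_eq_of_natDegree_le le_rfl hk.le, hE,
      coeff_eq_zero_of_natDegree_lt (show S.natDegree < Q.natDegree + (k + 1) by omega)]
    simp
  have hcoeff := congrArg
    (fun p => p.coeff (Q.natDegree + (k + 1) + S.natDegree + k)) hH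
  rw [coeff_mul_add_eq_of_natDegree_le (natDegree_mul_le_of_le hA.le le_rfl)
      (natDegree_add_derivative_le h hk),
    coeff_mul_add_eq_of_natDegree_le hA.le le_rfl, hAc, coeff_add_derivative h hk,
    show Q.natDegree + (k + 1) + S.natDegree + k = S.natDegree + k + (Q.natDegree + (k + 1)) by
      ring,
    coeff_mul_add_eq_of_natDegree_le hU hG, coeff_second_numerator h hk le_rfl,
    coeff_mul_sub h.monic hk hd hs] at hcoeff
  refine mul_left_cancel₀ (leadingCoeff_ne_zero.mpr hS0) ?_
  rw [leadingCoeff]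
  linear_combination -hcoeff

/-- The partial fraction expansion `(R - R') / (R - v) = c + F / E`. -/
theorem exists_numerator_eq_mul (h : IsLogDeriv Q E D F) (hPQ : IsCoprime P Q)
    (hS : S = derivative P * E - P * F) (hd : P.natDegree = Q.natDegree)
    {k : ℕ} (hk : E.natDegree = k + 1) {v : K} (hv0 : v ≠ 0)
    (hv : SharesValue P Q E S v) (hB : P.leadingCoeff - v * Q.leadingCoeff ≠ 0) :
    ∃ c, (P.leadingCoeff - v * Q.leadingCoeff) * c = P.leadingCoeff ∧
      P * E - S = (P - C v * Q) * (F + C c * E) := by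
  have hs := natDegree_numerator_le h hS hk hd.le
  have hG := natDegree_mul_sub_le hk hd.le hs
  have hGc := coeff_mul_sub h.monic hk hd.le hs
  obtain ⟨T, hT⟩ := hv.sub_dvd h hPQ hS hv0
  have hBle : (P - C v * Q).natDegree ≤ Q.natDegree :=
    (natDegree_sub_le_of_le hd.le (natDegree_C_mul_le v Q)).trans (max_self _).le
  have hBc : (P - C v * Q).coeff Q.natDegree = P.leadingCoeff - v * Q.leadingCoeff := by
    rw [coeff_sub, coeff_C_mul, leadingCoeff, leadingCoeff, hd]
  have hBdeg : (P - C v * Q).natDegree = Q.natDegree :=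
    natDegree_eq_of_le_of_coeff_ne_zero hBle (by rwa [hBc])
  have hB0 : P - C v * Q ≠ 0 := fun h0 => hB (by rw [← hBc, h0, coeff_zero])
  have hTdeg : T.natDegree ≤ k + 1 := by
    by_cases hT0 : T = 0
    · simp [hT0]
    · rw [hT, natDegree_mul hB0 hT0, hBdeg] at hG
      omega
  have hTc : (P.leadingCoeff - v * Q.leadingCoeff) * T.coeff (k + 1) = P.leadingCoeff := by
    rw [hT, coeff_mul_add_eq_of_natDegree_le hBle hTdeg, hBc, ← hd] at hGc
    exact hGc
  refine ⟨T.coeff (k + 1), hTc, ?_⟩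
  have hEP : IsCoprime E P := (hPQ.of_isCoprime_of_dvd_right ⟨D, h.eq_mul⟩).symm
  have hdvd : E ∣ T - F := by
    refine hEP.dvd_of_dvd_mul_left (?_ : E ∣ P * (T - F))
    exact ⟨P - derivative P + C v * D * T, by
      linear_combination -hT - hS + C v * T * h.eq_mul⟩
  have hzero : T - F - C (T.coeff (k + 1)) * E = 0 := by
    refine eq_zero_of_dvd_of_degree_lt (dvd_sub hdvd (dvd_mul_left _ _)) ?_
    have hF : F.natDegree ≤ k := by simpa [hk] using h.natDegree_le
    have hE : E.coeff (k + 1) = 1 := by rw [← hk]; exact h.monic.coeff_natDegree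
    rw [degree_eq_natDegree h.monic.ne_zero, hk, degree_lt_iff_coeff_zero]
    intro m hm
    rw [coeff_sub, coeff_sub, coeff_C_mul,
      coeff_eq_zero_of_natDegree_lt (show F.natDegree < m by omega)]
    rcases hm.eq_or_lt with rfl | hm
    · rw [hE]; ring
    · rw [coeff_eq_zero_of_natDegree_lt (show T.natDegree < m by omega),
        coeff_eq_zero_of_natDegree_lt (show E.natDegree < m by omega)]
      ring
  rw [hT]
  linear_combination (P - C v * Q) * hzero

theorem not_sharesValue_zero_of_natDegree_le (h : IsLogDeriv Q E D F) (hPQ : IsCoprime P Q)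
    (hS : S = derivative P * E - P * F) (hd : P.natDegree ≤ Q.natDegree)
    (hq : 1 ≤ Q.natDegree) {v : K} (hv0 : v ≠ 0) (hv : SharesValue P Q E S v)
    (h0 : SharesValue P Q E S 0) : False := by
  have hQ0 : Q ≠ 0 := by rintro rfl; simp at hq
  have hlcQ : Q.leadingCoeff ≠ 0 := leadingCoeff_ne_zero.mpr hQ0
  have hP0 : P ≠ 0 := by
    rintro rfl
    have := natDegree_eq_zero_of_isUnit (isCoprime_zero_left.mp hPQ)
    omega
  obtain ⟨k, hk⟩ := Nat.exists_eq_add_of_le' (h.one_le_natDegree hq)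
  have hkq := h.natDegree_le_natDegree hQ0
  obtain ⟨N, M, L, hP⟩ := exists_isLogDeriv hP0
  obtain ⟨c₀, hc₀, hSM, -⟩ := h0.exists_eq_mul_C h hP hPQ hS
  have hM0 : M ≠ 0 := by rintro rfl; exact hP0 (by simpa using hP.eq_mul)
  have hS0 : S ≠ 0 := by rw [hSM]; exact mul_ne_zero hM0 (C_ne_zero.mpr hc₀)
  have hSdeg : S.natDegree = M.natDegree := by rw [hSM, natDegree_mul_C hc₀]
  obtain ⟨hH, hlead⟩ := eq_add_derivative_and_coeff_eq h hPQ hS hS0 hd hQ0 hk hv0 hv h0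
  have hqk : (Q.natDegree + (k + 1) : K) ≠ 0 := by
    exact_mod_cast (by omega : Q.natDegree + (k + 1) ≠ 0)
  have hPc : P.coeff Q.natDegree ≠ 0 := by
    intro hPc
    rw [hPc, mul_zero] at hlead
    exact mul_ne_zero (mul_ne_zero hv0 hlcQ) hqk hlead
  have hdeg : P.natDegree = Q.natDegree := natDegree_eq_of_le_of_coeff_ne_zero hd hPc
  obtain ⟨hM, -⟩ := h0.natDegree_radical_lt h hP hPQ hS (by omega)
  have hs : (S.natDegree : K) ≠ 0 := by exact_mod_cast (by omega : S.natDegree ≠ 0)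
  rw [← hdeg, coeff_natDegree, hdeg] at hlead
  have hB : (Q.natDegree + (k + 1)) * (P.leadingCoeff - v * Q.leadingCoeff) =
      S.natDegree * P.leadingCoeff := by linear_combination -hlead
  have hB0 : P.leadingCoeff - v * Q.leadingCoeff ≠ 0 := by
    intro h0
    rw [h0, mul_zero] at hB
    exact mul_ne_zero hs (leadingCoeff_ne_zero.mpr hP0) hB.symm
  obtain ⟨c, hc, hG⟩ := exists_numerator_eq_mul h hPQ hS hdeg hk hv0 hv hB0
  have hcs : c * S.natDegree = Q.natDegree + (k + 1) := by
    refine mul_left_cancel₀ hB0 ?_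
    linear_combination S.natDegree * hc - hB
  have hE0 : E ≠ 0 := h.monic.ne_zero
  have hP' : C c * P - C v * D * (F + C c * E) = P - derivative P := by
    refine mul_left_cancel₀ hE0 ?_
    linear_combination -hG - hS + C v * (F + C c * E) * h.eq_mul
  have hdvd1 : E ∣ derivative S + (F + derivative E) * P := by
    refine (h.isCoprime_right hPQ hS).dvd_of_dvd_mul_left
      (⟨C v * D * S * (F + derivative E) + derivative S * P, mul_left_cancel₀ hE0 ?_⟩ :
        E ∣ S * (derivative S + (F + derivative E) * P))
    linear_combination hH + C v * E * S * (F + derivative E) * h.eq_mul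
  have hEP : IsCoprime E P := (hPQ.of_isCoprime_of_dvd_right ⟨D, h.eq_mul⟩).symm
  have hdvd : E ∣ C c * (F - derivative E) + C 2 * derivative E - derivative F := by
    obtain ⟨G₁, hG₁⟩ := hdvd1
    obtain ⟨G₂, hG₂⟩ := h.dvd_mul_sub_derivative
    refine hEP.dvd_of_dvd_mul_left
      (⟨G₁ - derivative (derivative P) + C v * (F + C c * E) * G₂, ?_⟩ :
        E ∣ P * (C c * (F - derivative E) + C 2 * derivative E - derivative F))
    have hS' := congrArg derivative hS
    simp only [derivative_sub, derivative_mul] at hS'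
    rw [show (C 2 : K[X]) = 2 from rfl]
    linear_combination hG₁ - hS' + C v * (F + C c * E) * hG₂ - (derivative E - F) * hP'
  have hF : F.natDegree ≤ k := by simpa [hk] using h.natDegree_le
  have hFc : F.coeff k = Q.natDegree := by simpa [hk] using h.coeff_eq
  have hE : E.coeff (k + 1) = 1 := by rw [← hk]; exact h.monic.coeff_natDegree
  have hE' : (derivative E).degree < E.degree := degree_derivative_lt hE0
  have hF' : (derivative F).degree < E.degree := degree_derivative_le.trans_lt h.degree_lt
  have hzero : C c * (F - derivative E) + C 2 * derivative E - derivative F = 0 := by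
    refine eq_zero_of_dvd_of_degree_lt hdvd ?_
    have hC (x : K) {p : K[X]} (hp : p.degree < E.degree) : (C x * p).degree < E.degree := by
      rw [← smul_eq_C_mul]
      exact (degree_smul_le x p).trans_lt hp
    have h1 : (F - derivative E).degree < E.degree :=
      (degree_sub_le _ _).trans_lt (max_lt h.degree_lt hE')
    exact (degree_sub_le _ _).trans_lt (max_lt
      ((degree_add_le _ _).trans_lt (max_lt (hC c h1) (hC 2 hE'))) hF')
  have hcoeff := congrArg (fun p => p.coeff k) hzero
  simp only [coeff_sub, coeff_add, coeff_C_mul, coeff_derivative, hE, hFc, coeff_zero,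
    coeff_eq_zero_of_natDegree_lt (show F.natDegree < k + 1 by omega)] at hcoeff
  obtain ⟨r, hr⟩ := Nat.exists_eq_add_of_le (hk ▸ hkq)
  have hcontra : ((Q.natDegree + (k + 1)) * r + 2 * (k + 1) * S.natDegree : K) = 0 := by
    have hrK : (Q.natDegree : K) = k + 1 + r := by exact_mod_cast congrArg Nat.cast hr
    linear_combination S.natDegree * hcoeff - r * hcs - c * S.natDegree * hrK
  have hnat : (Q.natDegree + (k + 1)) * r + 2 * (k + 1) * S.natDegree = 0 := by
    exact_mod_cast hcontra
  have : 0 < (k + 1) * S.natDegree := Nat.mul_pos (by omega) (by omega)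
  nlinarith

theorem not_sharesValue_zero (h : IsLogDeriv Q E D F) (hPQ : IsCoprime P Q)
    (hS : S = derivative P * E - P * F) (hd : 1 ≤ max P.natDegree Q.natDegree) {v : K}
    (hv0 : v ≠ 0) (hv : SharesValue P Q E S v) : ¬ SharesValue P Q E S 0 := by
  intro h0
  rcases le_or_gt P.natDegree Q.natDegree with hle | hlt
  · exact not_sharesValue_zero_of_natDegree_le h hPQ hS hle (by omega) hv0 hv h0
  · exact not_sharesValue_zero_of_natDegree_lt h hPQ hS hlt hv0 hv h0

theorem not_sharesValue_of_ne (h : IsLogDeriv Q E D F) (hPQ : IsCoprime P Q) (hQ : Q ≠ 0)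
    (hS : S = derivative P * E - P * F) (hd : 1 ≤ max P.natDegree Q.natDegree) {v w : K}
    (hvw : v ≠ w) (hv : SharesValue P Q E S v) : ¬ SharesValue P Q E S w := by
  intro hw
  by_cases hv0 : v = 0
  · exact not_sharesValue_zero h hPQ hS hd (hv0 ▸ hvw.symm) hw (hv0 ▸ hv)
  by_cases hw0 : w = 0
  · exact not_sharesValue_zero h hPQ hS hd hv0 hv (hw0 ▸ hw)
  rcases le_or_gt P.natDegree Q.natDegree with hle | hlt
  · exact not_sharesValue_of_natDegree_le h hPQ hS hle (by omega) hvw hv0 hw0 hv hw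
  · exact not_sharesValue_of_natDegree_lt h hPQ hQ hS hlt hvw hv0 hw0 hv hw

end SharedValues

/-- A non-constant rational function `R = P/Q` cannot share two distinct finite values
with its derivative in the plane `ℂ`. -/
theorem rational_cannot_share_two_values_in_plane
    (P Q : ℂ[X]) (hPQ : IsCoprime P Q) (hQ : Q ≠ 0)
    (hd : 1 ≤ max P.natDegree Q.natDegree)
    (a b : ℂ) (hab : a ≠ b) :
    ¬ (∀ v ∈ ({a, b} : Set ℂ), ∀ z : ℂ, Q.eval z ≠ 0 →
        (P.eval z = v * Q.eval z ↔
          (derivative P * Q - P * derivative Q).eval z = v * (Q.eval z) ^ 2)) := by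
  intro hshare
  obtain ⟨E, D, F, h⟩ := SharedValues.exists_isLogDeriv hQ
  exact SharedValues.not_sharesValue_of_ne h hPQ hQ rfl hd hab
    (SharedValues.sharesValue_of_forall h hPQ rfl (hshare a (by simp)))
    (SharedValues.sharesValue_of_forall h hPQ rfl (hshare b (by simp)))
end

section
/- Fix λ ∈ ℂ with λ ≠ 0 and let R = P/Q be a non-constant rational function, with P, Q ∈ ℂ[X] coprime, Q ≠ 0 and max(deg P, deg Q) ≥ 1. Then P·Q = λ·X·(P'·Q − P·Q') in ℂ[X] (i.e., R ≡ ∂_z R) if and only if there exist c ∈ ℂ∖{0} and an integer n ≠ 0 with λ·n = 1 such that for every w ∈ ℂ∖{0} with Q(w) ≠ 0 one has P(w)/Q(w) = c·w^n. -/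
open Polynomial

/-- A complex polynomial dividing its image under the Euler operator `X · d/dX` is a monomial. -/
theorem eq_C_mul_X_pow_of_dvd_X_mul_derivative {A : ℂ[X]} (h : A ∣ X * derivative A) :
    A = C A.leadingCoeff * X ^ A.natDegree := by
  rcases eq_or_ne A 0 with rfl | hA
  · simp
  obtain ⟨B, hB⟩ := h
  have hB0 : B.natDegree = 0 := by
    rcases eq_or_ne B 0 with rfl | hBne
    · simp
    have h1 : (A * B).natDegree ≤ A.natDegree := by
      rw [← hB, natDegree_le_iff_coeff_eq_zero]
      rintro (_ | i) hi
      · simp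
      · simp [coeff_X_mul, coeff_derivative, coeff_eq_zero_of_natDegree_lt hi]
    rw [natDegree_mul hA hBne] at h1
    omega
  obtain ⟨k, rfl⟩ := natDegree_eq_zero.mp hB0
  have hcoeff (i : ℕ) : (i : ℂ) * A.coeff i = k * A.coeff i := by
    have h2 := congrArg (fun p => p.coeff i) hB
    rcases i with _ | i
    · simpa [mul_comm, eq_comm] using h2
    · simpa [coeff_X_mul, coeff_derivative, mul_comm] using h2
  have hk : (A.natDegree : ℂ) = k :=
    mul_right_cancel₀ (leadingCoeff_ne_zero.mpr hA) (hcoeff A.natDegree)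
  ext i
  rw [coeff_C_mul_X_pow]
  split_ifs with hi
  · rw [hi, leadingCoeff]
  · by_contra hne
    exact hi (Nat.cast_injective ((mul_right_cancel₀ hne (hcoeff i)).trans hk.symm))

theorem X_mul_derivative_C_mul_X_pow (a : ℂ) (p : ℕ) :
    X * derivative (C a * X ^ p) = C (p : ℂ) * (C a * X ^ p) := by
  rcases p with _ | p
  · simp
  · simp only [derivative_C_mul_X_pow, Nat.add_sub_cancel, C_mul]
    ring

/-- For a non-constant rational function `R = P/Q`, one has `R ≡ ∂_z R`
(i.e. `P·Q = λ·X·(P'·Q − P·Q')` in `ℂ[X]`) if and only if `R(w) = c·w^n`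
with `c ≠ 0` and a non-zero integer `n` with `λ·n = 1`. -/
theorem R_eq_dzR_iff
    (l : ℂ) (hl : l ≠ 0)
    (P Q : ℂ[X]) (hPQ : IsCoprime P Q) (hQ : Q ≠ 0)
    (hd : 1 ≤ max P.natDegree Q.natDegree) :
    P * Q = C l * X * (derivative P * Q - P * derivative Q) ↔
      ∃ (c : ℂ) (n : ℤ), c ≠ 0 ∧ n ≠ 0 ∧ l * n = 1 ∧
        ∀ w : ℂ, w ≠ 0 → Q.eval w ≠ 0 →
          P.eval w / Q.eval w = c * w ^ n := by
  constructor
  · intro h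
    have hP : P ≠ 0 := by
      rintro rfl
      have := natDegree_eq_zero_of_isUnit (isCoprime_zero_left.mp hPQ)
      simp [this] at hd
    have hCl : C l * C l⁻¹ = 1 := by rw [← C_mul, mul_inv_cancel₀ hl, C_1]
    have hPd : P ∣ X * derivative P :=
      hPQ.dvd_of_dvd_mul_right
        ⟨C l⁻¹ * Q + X * derivative Q, by
          linear_combination -(C l⁻¹) * h - X * (derivative P * Q - P * derivative Q) * hCl⟩
    have hQd : Q ∣ X * derivative Q :=
      hPQ.symm.dvd_of_dvd_mul_right
        ⟨X * derivative P - C l⁻¹ * P, by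
          linear_combination (C l⁻¹) * h + X * (derivative P * Q - P * derivative Q) * hCl⟩
    have hPm := eq_C_mul_X_pow_of_dvd_X_mul_derivative hPd
    have hQm := eq_C_mul_X_pow_of_dvd_X_mul_derivative hQd
    have hPe := X_mul_derivative_C_mul_X_pow P.leadingCoeff P.natDegree
    have hQe := X_mul_derivative_C_mul_X_pow Q.leadingCoeff Q.natDegree
    rw [← hPm] at hPe
    rw [← hQm] at hQe
    have hn : l * ((P.natDegree : ℂ) - Q.natDegree) = 1 := by
      apply C_injective
      apply mul_right_cancel₀ (mul_ne_zero hP hQ)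
      simp only [C_mul, C_sub, C_1]
      linear_combination -h - C l * Q * hPe + C l * P * hQe
    have hn' : l * (((P.natDegree : ℤ) - Q.natDegree : ℤ) : ℂ) = 1 := by
      push_cast
      exact hn
    refine ⟨P.leadingCoeff / Q.leadingCoeff, (P.natDegree : ℤ) - Q.natDegree,
      div_ne_zero (leadingCoeff_ne_zero.mpr hP) (leadingCoeff_ne_zero.mpr hQ), ?_, hn', ?_⟩
    · intro h0
      simp [h0] at hn'
    · intro w hw _
      have hPw := congrArg (eval w) hPm
      have hQw := congrArg (eval w) hQm
      simp only [eval_mul, eval_C, eval_pow, eval_X] at hPw hQw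
      rw [hPw, hQw, zpow_sub₀ hw, zpow_natCast, zpow_natCast, mul_div_mul_comm]
  · rintro ⟨c, n, -, -, hn, h⟩
    obtain ⟨p, q, rfl⟩ : ∃ p q : ℕ, n = p - q := ⟨n.toNat, (-n).toNat, by omega⟩
    have hpoly : P * X ^ q = C c * X ^ p * Q := by
      have hXQ : X * Q ≠ 0 := mul_ne_zero X_ne_zero hQ
      apply mul_left_cancel₀ hXQ
      apply Polynomial.funext
      intro w
      simp only [eval_mul, eval_C, eval_pow, eval_X]
      rcases eq_or_ne w 0 with rfl | hw
      · simp
      rcases eq_or_ne (Q.eval w) 0 with hQw | hQw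
      · simp [hQw]
      have hw' := h w hw hQw
      rw [zpow_sub₀ hw, zpow_natCast, zpow_natCast] at hw'
      field_simp at hw'
      linear_combination w * Q.eval w * hw'
    have hder := congrArg derivative hpoly
    rw [derivative_mul, derivative_mul] at hder
    have hq := X_mul_derivative_C_mul_X_pow 1 q
    have hp := X_mul_derivative_C_mul_X_pow c p
    simp only [C_1, one_mul] at hq
    have hl' : C l * (C (p : ℂ) - C (q : ℂ)) = 1 := by
      rw [← C_sub, ← C_mul, ← C_1]
      congr 1
      push_cast at hn
      exact hn
    apply mul_left_cancel₀ (pow_ne_zero q (X_ne_zero (R := ℂ)))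
    linear_combination (-(X ^ q * P * Q)) * hl' - C l * X * Q * hder
      + C l * P * Q * hq - C l * Q * Q * hp + C l * (X * derivative Q + C (p : ℂ) * Q) * hpoly
end

section
/- Fix λ ∈ ℂ with λ ≠ 0, let R = P/Q be a non-constant rational function (P, Q ∈ ℂ[X] coprime, Q ≠ 0, max(deg P, deg Q) ≥ 1), and let a, b ∈ ℂ with a ≠ b. If R and ∂_z R share the value a on the sphere ℂ∪{∞} and also share the value b on the sphere ℂ∪{∞}, then P·Q = λ·X·(P'·Q − P·Q') in ℂ[X] (i.e., R ≡ ∂_z R). -/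
open Polynomial

namespace SharedValues

theorem dvd_of_rootMultiplicity_le {p q : ℂ[X]} (hp : p ≠ 0) (hq : q ≠ 0)
    (h : ∀ w, p.IsRoot w → p.rootMultiplicity w ≤ q.rootMultiplicity w) : p ∣ q := by
  classical
  refine ((IsAlgClosed.splits p).dvd_iff_roots_le_roots hp hq).2 ?_
  rw [Multiset.le_iff_count]
  intro w
  rw [count_roots, count_roots]
  by_cases hw : p.IsRoot w
  · exact h w hw
  · rw [rootMultiplicity_eq_zero hw]
    exact Nat.zero_le _

theorem eval_ne_zero_of_isCoprime_s12 {P Q : ℂ[X]} (hPQ : IsCoprime P Q) {w : ℂ}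
    (hP : P.eval w = 0) : Q.eval w ≠ 0 := by
  intro hQ
  obtain ⟨u, v, h⟩ := hPQ
  have := congrArg (eval w) h
  simp [hP, hQ] at this

theorem natDegree_sub_le_of_both_le {p q : ℂ[X]} {n : ℕ} (hp : p.natDegree ≤ n)
    (hq : q.natDegree ≤ n) : (p - q).natDegree ≤ n :=
  (natDegree_sub_le p q).trans (max_le hp hq)

theorem natDegree_X_mul_derivative_le (P : ℂ[X]) : (X * derivative P).natDegree ≤ P.natDegree := by
  by_cases h : P.natDegree = 0
  · rw [natDegree_eq_zero] at h
    obtain ⟨c, rfl⟩ := h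
    simp
  · have h1 := natDegree_derivative_lt h
    have h2 : (X * derivative P).natDegree ≤ _ := natDegree_mul_le
    rw [natDegree_X] at h2
    omega

theorem natDegree_X_mul_wronskian_le (P Q : ℂ[X]) :
    (X * (derivative P * Q - P * derivative Q)).natDegree ≤ P.natDegree + Q.natDegree := by
  have e : X * (derivative P * Q - P * derivative Q)
      = (X * derivative P) * Q - P * (X * derivative Q) := by ring
  rw [e]
  refine natDegree_sub_le_of_both_le (natDegree_mul_le_of_le (natDegree_X_mul_derivative_le P) le_rfl)
    (natDegree_mul_le_of_le le_rfl (natDegree_X_mul_derivative_le Q))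

theorem coeff_X_mul_derivative (P : ℂ[X]) (n : ℕ) :
    (X * derivative P).coeff n = n * P.coeff n := by
  cases n with
  | zero => simp
  | succ n => rw [coeff_X_mul, coeff_derivative]; push_cast; ring

theorem coeff_X_mul_wronskian (P Q : ℂ[X]) :
    (X * (derivative P * Q - P * derivative Q)).coeff (P.natDegree + Q.natDegree)
      = ((P.natDegree : ℂ) - Q.natDegree) * (P.leadingCoeff * Q.leadingCoeff) := by
  have e : X * (derivative P * Q - P * derivative Q)
      = (X * derivative P) * Q - P * (X * derivative Q) := by ring
  rw [e, coeff_sub, coeff_mul_add_eq_of_natDegree_le (natDegree_X_mul_derivative_le P) le_rfl,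
    coeff_mul_add_eq_of_natDegree_le le_rfl (natDegree_X_mul_derivative_le Q),
    coeff_X_mul_derivative, coeff_X_mul_derivative, leadingCoeff, leadingCoeff]
  ring

theorem rootMultiplicity_wronskian_lt {P Q : ℂ[X]} (hPQ : IsCoprime P Q) (hP : P ≠ 0)
    (hW : derivative P * Q - P * derivative Q ≠ 0) {w : ℂ} (hw : P.IsRoot w) :
    (derivative P * Q - P * derivative Q).rootMultiplicity w < P.rootMultiplicity w := by
  by_contra! hle
  have h1 : (X - C w) ^ P.rootMultiplicity w ∣ derivative P * Q - P * derivative Q :=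
    (le_rootMultiplicity_iff hW).1 hle
  have h2 : (X - C w) ^ P.rootMultiplicity w ∣ P := pow_rootMultiplicity_dvd P w
  have h3 : (X - C w) ^ P.rootMultiplicity w ∣ derivative P * Q :=
    (dvd_sub_left (h2.mul_right _)).1 h1
  have h4 := (hPQ.of_isCoprime_of_dvd_left h2).dvd_of_dvd_mul_right h3
  have h5 := (rootMultiplicity_pos hP).2 hw
  have hP' : derivative P ≠ 0 := by
    intro h
    have := derivative_eq_zero.1 h
    rw [natDegree_eq_zero] at this
    obtain ⟨c, rfl⟩ := this
    simp at hw
    simp [hw] at hP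
  have h6 := (le_rootMultiplicity_iff hP').2 h4
  rw [derivative_rootMultiplicity_of_root hw] at h6
  omega

theorem wronskian_ne_zero {P Q : ℂ[X]} (hPQ : IsCoprime P Q)
    (hd : 1 ≤ max P.natDegree Q.natDegree) :
    derivative P * Q - P * derivative Q ≠ 0 := by
  intro h
  have hw : wronskian P Q = 0 := by
    rw [wronskian]
    linear_combination -h
  obtain ⟨h1, h2⟩ := hPQ.wronskian_eq_zero_iff.1 hw
  have h1 := derivative_eq_zero.1 h1
  have h2 := derivative_eq_zero.1 h2
  simp [h1, h2] at hd

theorem ne_zero_of_isCoprime {P Q : ℂ[X]} (hPQ : IsCoprime P Q)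
    (hd : 1 ≤ max P.natDegree Q.natDegree) : P ≠ 0 := by
  rintro rfl
  have := natDegree_eq_zero_of_isUnit (isCoprime_zero_left.1 hPQ)
  simp [this] at hd

/-- The value `v` is shared on the Riemann sphere by `R = P / Q` and `l * X * R'`. -/
def Shares (l : ℂ) (P Q : ℂ[X]) (v : ℂ) : Prop :=
  (∀ w : ℂ, w ≠ 0 → Q.eval w ≠ 0 →
    (P.eval w = v * Q.eval w ↔
      l * w * (derivative P * Q - P * derivative Q).eval w = v * (Q.eval w) ^ 2)) ∧
  ((Q.eval 0 ≠ 0 ∧ P.eval 0 = v * Q.eval 0) ↔ (Q.eval 0 ≠ 0 ∧ v = 0)) ∧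
  ((P - C v * Q).degree < Q.degree ↔
    (C l * X * (derivative P * Q - P * derivative Q) - C v * Q ^ 2).degree <
      Q.degree + Q.degree)

theorem eq_of_shares_zero {l : ℂ} (hl : l ≠ 0) {P Q : ℂ[X]} (hPQ : IsCoprime P Q) (hQ : Q ≠ 0)
    (hd : 1 ≤ max P.natDegree Q.natDegree) {b : ℂ} (hb : b ≠ 0)
    (h0 : Shares l P Q 0) (hbs : Shares l P Q b) :
    P * Q = C l * X * (derivative P * Q - P * derivative Q) := by
  have hP := ne_zero_of_isCoprime hPQ hd
  have hW := wronskian_ne_zero hPQ hd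
  have hPQ0 : P * Q ≠ 0 := mul_ne_zero hP hQ
  have hXW : X * (derivative P * Q - P * derivative Q) ≠ 0 := mul_ne_zero X_ne_zero hW
  have cW := coeff_X_mul_wronskian P Q
  have dW := natDegree_X_mul_wronskian_le P Q
  have hW' : derivative Q * P - Q * derivative P ≠ 0 := by
    intro h
    apply hW
    linear_combination -h
  have hW'm : ∀ w, (derivative P * Q - P * derivative Q).rootMultiplicity w
      = (derivative Q * P - Q * derivative P).rootMultiplicity w := by
    intro w
    have e : derivative P * Q - P * derivative Q
        = C (-1) * (derivative Q * P - Q * derivative P) := by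
      simp only [map_neg, map_one]; ring
    have hne : C (-1 : ℂ) * (derivative Q * P - Q * derivative P) ≠ 0 := e ▸ hW
    rw [e, rootMultiplicity_mul hne, rootMultiplicity_C, zero_add]
  obtain ⟨h1, h2, h3⟩ := h0
  have hz : (P * Q).IsRoot 0 := by
    by_cases hq : Q.eval 0 = 0
    · simp [hq]
    · have := (h2.2 ⟨hq, rfl⟩).2
      simp only [zero_mul] at this
      simp [this]
  have hne : P.natDegree ≠ Q.natDegree := by
    intro he
    have hlt : (C l * X * (derivative P * Q - P * derivative Q) - C 0 * Q ^ 2).degree <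
        Q.degree + Q.degree := by
      have hc : (X * (derivative P * Q - P * derivative Q)).coeff (Q.natDegree + Q.natDegree)
          = 0 := by
        rw [he] at cW
        rw [cW]
        ring
      rw [he] at dW
      rw [map_zero, zero_mul, sub_zero, mul_assoc, degree_C_mul hl, degree_eq_natDegree hQ]
      have hle := degree_le_of_natDegree_le dW
      rw [← Nat.cast_add]
      refine lt_of_le_of_ne hle fun h => ?_
      exact (coeff_ne_zero_of_eq_degree h) hc
    have := h3.2 hlt
    rw [map_zero, zero_mul, sub_zero, degree_eq_natDegree hP, degree_eq_natDegree hQ, he] at this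
    exact lt_irrefl _ this
  have hmult : ∀ w, (P * Q).IsRoot w →
      (derivative P * Q - P * derivative Q).rootMultiplicity w
        < (P * Q).rootMultiplicity w := by
    intro w hw
    rw [rootMultiplicity_mul hPQ0]
    rcases root_mul.1 hw with hw | hw
    · have := rootMultiplicity_wronskian_lt hPQ hP hW hw
      omega
    · have := rootMultiplicity_wronskian_lt hPQ.symm hQ hW' hw
      rw [hW'm]
      omega
  have hdvd : X * (derivative P * Q - P * derivative Q) ∣ P * Q := by
    refine dvd_of_rootMultiplicity_le hXW hPQ0 fun w hw => ?_
    rw [rootMultiplicity_mul hXW]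
    have hX : (X : ℂ[X]).rootMultiplicity w ≤ 1 := by
      classical
      rw [← count_roots, roots_X, Multiset.count_singleton]
      split_ifs <;> simp
    by_cases hr : (P * Q).IsRoot w
    · have := hmult w hr
      omega
    · exfalso
      have hw0 : w ≠ 0 := by
        rintro rfl
        exact hr hz
      rw [IsRoot, eval_mul] at hr
      have hq : Q.eval w ≠ 0 := right_ne_zero_of_mul hr
      have hWw : (derivative P * Q - P * derivative Q).eval w = 0 := by
        rw [IsRoot, eval_mul, eval_X] at hw
        exact (mul_eq_zero.1 hw).resolve_left hw0
      have := (h1 w hw0 hq).2 (by rw [hWw]; ring)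
      rw [zero_mul] at this
      exact hr (by rw [this, zero_mul])
  obtain ⟨T, hT⟩ := hdvd
  have hT0 : T ≠ 0 := by
    rintro rfl
    exact hPQ0 (by rw [hT, mul_zero])
  have hTd : T.natDegree = 0 := by
    have e1 := natDegree_mul hP hQ
    rw [hT, natDegree_mul hXW hT0] at e1
    have : P.natDegree + Q.natDegree ≤
        (X * (derivative P * Q - P * derivative Q)).natDegree := by
      apply le_natDegree_of_ne_zero
      rw [cW]
      refine mul_ne_zero (sub_ne_zero.2 (by exact_mod_cast hne)) (mul_ne_zero ?_ ?_)
      · exact leadingCoeff_ne_zero.2 hP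
      · exact leadingCoeff_ne_zero.2 hQ
    omega
  obtain ⟨c, rfl⟩ := natDegree_eq_zero.1 hTd
  obtain ⟨w, hw⟩ : ∃ w, (P - C b * Q).IsRoot w := by
    apply IsAlgClosed.exists_root
    intro h
    have h : (P - C b * Q).natDegree = 0 := natDegree_eq_of_degree_eq_some h
    have hbQ : (C b * Q).natDegree = Q.natDegree := natDegree_C_mul hb
    rcases lt_or_gt_of_ne hne with hlt | hlt
    · rw [natDegree_sub_eq_right_of_natDegree_lt (by rwa [hbQ]), hbQ] at h
      omega
    · rw [natDegree_sub_eq_left_of_natDegree_lt (by rwa [hbQ])] at h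
      omega
  have hw' : P.eval w = b * Q.eval w := by
    simpa [IsRoot, sub_eq_zero] using hw
  have hq : Q.eval w ≠ 0 := by
    intro h
    refine eval_ne_zero_of_isCoprime_s12 hPQ (w := w) ?_ h
    rw [hw', h, mul_zero]
  have hw0 : w ≠ 0 := by
    rintro rfl
    rw [IsRoot, eval_mul, hw'] at hz
    exact mul_ne_zero (mul_ne_zero hb hq) hq hz
  have h4 := (hbs.1 w hw0 hq).1 hw'
  have h5 := congrArg (eval w) hT
  rw [eval_mul, eval_mul, eval_mul, eval_X, eval_C, hw'] at h5
  have h6 : w * (derivative P * Q - P * derivative Q).eval w ≠ 0 := by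
    intro h
    have : b * Q.eval w ^ 2 = 0 := by rw [← h4, mul_assoc, h, mul_zero]
    exact mul_ne_zero hb (pow_ne_zero 2 hq) this
  have hcl : c = l := by
    apply mul_left_cancel₀ h6
    linear_combination -h5 - h4
  rw [hT, hcl]
  ring

theorem natDegree_le_of_shares {l : ℂ} {P Q : ℂ[X]} (hQ : Q ≠ 0) {v : ℂ} (hv : v ≠ 0)
    (h : Shares l P Q v) :
    max P.natDegree Q.natDegree ≤ (P - C v * Q).natDegree := by
  have hvQ : (C v * Q).natDegree = Q.natDegree := natDegree_C_mul hv
  have key : Q.natDegree ≤ (P - C v * Q).natDegree := by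
    apply natDegree_le_natDegree
    by_contra! hlt
    have h3 := h.2.2.1 hlt
    set H := P - C v * Q with hH
    have hq : Q.degree + Q.degree = ((Q.natDegree + Q.natDegree : ℕ) : WithBot ℕ) := by
      rw [degree_eq_natDegree hQ, Nat.cast_add]
    have hxw : (C l * X * (derivative P * Q - P * derivative Q)).degree
        < Q.degree + Q.degree := by
      have e : C l * X * (derivative P * Q - P * derivative Q)
          = C l * (X * (derivative H * Q - H * derivative Q)) := by
        rw [hH]
        simp only [derivative_sub, derivative_mul, derivative_C]
        ring
      rw [e]
      by_cases hH0 : H = 0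
      · simp [hH0, hq]
      · have hlt' : H.natDegree < Q.natDegree := natDegree_lt_natDegree hH0 hlt
        have h1 := natDegree_X_mul_wronskian_le H Q
        have h2 := natDegree_C_mul_le l (X * (derivative H * Q - H * derivative Q))
        rw [hq]
        refine lt_of_le_of_lt (degree_le_of_natDegree_le (h2.trans h1)) ?_
        exact_mod_cast Nat.add_lt_add_right hlt' _
    have h5 := (degree_sub_le (C l * X * (derivative P * Q - P * derivative Q))
      (C l * X * (derivative P * Q - P * derivative Q) - C v * Q ^ 2)).trans_lt (max_lt hxw h3)
    rw [sub_sub_cancel, degree_C_mul hv, sq, degree_mul] at h5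
    exact lt_irrefl _ h5
  refine max_le ?_ key
  have e : P = (P - C v * Q) + C v * Q := by ring
  have := natDegree_add_le (P - C v * Q) (C v * Q)
  rw [← e, hvQ] at this
  exact this.trans (max_le le_rfl key)

theorem root_properties_of_shares {l : ℂ} {P Q : ℂ[X]} (hPQ : IsCoprime P Q) {v : ℂ} (hv : v ≠ 0)
    (h : Shares l P Q v) {w : ℂ} (hw : P.eval w = v * Q.eval w) :
    Q.eval w ≠ 0 ∧ (derivative (P - C v * Q)).eval w ≠ 0 ∧
      (P * Q - C l * X * (derivative P * Q - P * derivative Q)).eval w = 0 := by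
  have hq : Q.eval w ≠ 0 := by
    intro hq
    refine eval_ne_zero_of_isCoprime_s12 hPQ (w := w) ?_ hq
    rw [hw, hq, mul_zero]
  have hw0 : w ≠ 0 := by
    rintro rfl
    exact hv (h.2.1.1 ⟨hq, hw⟩).2
  have h1 := (h.1 w hw0 hq).1 hw
  refine ⟨hq, fun hder => ?_, ?_⟩
  · have : v * Q.eval w ^ 2 = 0 := by
      rw [← h1]
      simp only [derivative_sub, derivative_mul, derivative_C, eval_sub, eval_mul,
        eval_C, zero_mul, zero_add] at hder ⊢
      rw [hw]
      linear_combination l * w * Q.eval w * hder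
    exact mul_ne_zero hv (pow_ne_zero 2 hq) this
  · rw [eval_sub, eval_mul, eval_mul, eval_mul, eval_C, eval_X, h1, hw]
    ring

theorem mul_dvd_of_shares {l : ℂ} {P Q : ℂ[X]} (hPQ : IsCoprime P Q) (hQ : Q ≠ 0)
    (hd : 1 ≤ max P.natDegree Q.natDegree) {a b : ℂ} (hab : a ≠ b) (ha : a ≠ 0) (hb : b ≠ 0)
    (has : Shares l P Q a) (hbs : Shares l P Q b) :
    (P - C a * Q) * (P - C b * Q) ∣
      P * Q - C l * X * (derivative P * Q - P * derivative Q) := by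
  by_cases hN : P * Q - C l * X * (derivative P * Q - P * derivative Q) = 0
  · rw [hN]
    exact dvd_zero _
  have hF : (P - C a * Q) * (P - C b * Q) ≠ 0 := by
    refine mul_ne_zero ?_ ?_
    · exact ne_zero_of_natDegree_gt (hd.trans (natDegree_le_of_shares hQ ha has))
    · exact ne_zero_of_natDegree_gt (hd.trans (natDegree_le_of_shares hQ hb hbs))
  refine dvd_of_rootMultiplicity_le hF hN fun w hw => ?_
  have hba : b - a ≠ 0 := sub_ne_zero.2 hab.symm
  have hab' : a - b ≠ 0 := sub_ne_zero.2 hab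
  have main : (derivative ((P - C a * Q) * (P - C b * Q))).eval w ≠ 0 ∧
      (P * Q - C l * X * (derivative P * Q - P * derivative Q)).eval w = 0 := by
    rcases root_mul.1 hw with hr | hr
    · have hr' : P.eval w = a * Q.eval w := by simpa [IsRoot, sub_eq_zero] using hr
      obtain ⟨hq, h2, h3⟩ := root_properties_of_shares hPQ ha has hr'
      refine ⟨?_, h3⟩
      have e : (P - C b * Q).eval w = (a - b) * Q.eval w := by
        simp [hr']; ring
      rw [derivative_mul, eval_add, eval_mul, eval_mul, hr.eq_zero, zero_mul, add_zero, e]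
      exact mul_ne_zero h2 (mul_ne_zero hab' hq)
    · have hr' : P.eval w = b * Q.eval w := by simpa [IsRoot, sub_eq_zero] using hr
      obtain ⟨hq, h2, h3⟩ := root_properties_of_shares hPQ hb hbs hr'
      refine ⟨?_, h3⟩
      have e : (P - C a * Q).eval w = (b - a) * Q.eval w := by
        simp [hr']; ring
      rw [derivative_mul, eval_add, eval_mul, eval_mul, hr.eq_zero, mul_zero, zero_add, e]
      exact mul_ne_zero (mul_ne_zero hba hq) h2
  have h1 : ¬ 1 < ((P - C a * Q) * (P - C b * Q)).rootMultiplicity w := by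
    rw [one_lt_rootMultiplicity_iff_isRoot hF]
    exact fun h => main.1 h.2
  have h2 := (rootMultiplicity_pos hN).2 main.2
  omega

theorem mul_sub_eq_one_of_shares {l : ℂ} {P Q : ℂ[X]} (hPQ : IsCoprime P Q)
    (hd : 1 ≤ max P.natDegree Q.natDegree) {a b k : ℂ} (ha : a ≠ 0) (hk : k ≠ 0)
    (has : Shares l P Q a)
    (h : P * Q - C l * X * (derivative P * Q - P * derivative Q)
      = (P - C a * Q) * (P - C b * Q) * C k) :
    k * (a - b) = 1 := by
  by_contra hne
  have hS : C l * X * (derivative P * Q - P * derivative Q) - C a * Q ^ 2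
      = (P - C a * Q) * (Q - C k * (P - C b * Q)) := by
    linear_combination -h
  have noroot : ∀ w, (Q - C k * (P - C b * Q)).eval w ≠ 0 := by
    intro w hw
    have hw' : Q.eval w - k * (P.eval w - b * Q.eval w) = 0 := by simpa using hw
    have hq : Q.eval w ≠ 0 := by
      intro hq
      rw [hq] at hw'
      refine eval_ne_zero_of_isCoprime_s12 hPQ (w := w) ?_ hq
      simpa [hk] using hw'
    have h1 := congrArg (eval w) hS
    rw [eval_mul (p := P - C a * Q), hw, mul_zero, eval_sub, eval_mul, eval_mul, eval_mul, eval_C,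
      eval_C, eval_X, eval_pow, sub_eq_zero] at h1
    by_cases hw0 : w = 0
    · have h1 : 0 = a * eval w Q ^ 2 := by
        rw [← h1, hw0, mul_zero, zero_mul]
      exact mul_ne_zero ha (pow_ne_zero 2 hq) h1.symm
    · have h2 := (has.1 w hw0 hq).2 h1
      rw [h2] at hw'
      apply hne
      apply mul_right_cancel₀ hq
      linear_combination -hw'
  have hdeg : (Q - C k * (P - C b * Q)).natDegree = 0 := by
    by_contra hd0
    obtain ⟨w, hw⟩ := IsAlgClosed.exists_root (Q - C k * (P - C b * Q))
      (fun h0 => hd0 (natDegree_eq_of_degree_eq_some h0))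
    exact noroot w hw
  obtain ⟨c, hc⟩ := natDegree_eq_zero.1 hdeg
  have hP : P = C k⁻¹ * (C (1 + k * b) * Q - C c) := by
    have hkk : C k⁻¹ * C k = (1 : ℂ[X]) := by rw [← C_mul, inv_mul_cancel₀ hk, C_1]
    simp only [C_add, C_mul, C_1]
    linear_combination (-P) * hkk + C k⁻¹ * hc
  have hle : P.natDegree ≤ Q.natDegree := by
    rw [hP]
    refine (natDegree_C_mul_le _ _).trans (natDegree_sub_le_of_both_le (natDegree_C_mul_le _ _) ?_)
    simp
  have hkP : C k * P = C (1 + k * b) * Q - C c := by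
    simp only [C_add, C_mul, C_1]
    linear_combination hc
  have hkP' : C k * derivative P = C (1 + k * b) * derivative Q := by
    have := congrArg derivative hkP
    simpa using this
  have e : C (k * a) * Q ^ 2
      = C (l * c) * (X * derivative Q) - (C (c * (1 + k * b - k * a)) * Q - C (c ^ 2)) := by
    rw [← hc] at hS
    simp only [C_add, C_sub, C_mul, C_1, C_pow] at hkP hkP' ⊢
    linear_combination (-C k) * hS + C l * X * Q * hkP' - C l * X * derivative Q * hkP - C c * hkP
  have hn := congrArg natDegree e
  rw [natDegree_C_mul (mul_ne_zero hk ha), natDegree_pow] at hn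
  have : (C (l * c) * (X * derivative Q)
      - (C (c * (1 + k * b - k * a)) * Q - C (c ^ 2))).natDegree ≤ Q.natDegree := by
    refine natDegree_sub_le_of_both_le
      ((natDegree_C_mul_le _ _).trans (natDegree_X_mul_derivative_le Q))
      (natDegree_sub_le_of_both_le (natDegree_C_mul_le _ _) ?_)
    rw [natDegree_C]
    exact Nat.zero_le _
  rw [max_eq_right hle] at hd
  omega

theorem eq_of_shares_ne_zero {l : ℂ} {P Q : ℂ[X]} (hPQ : IsCoprime P Q) (hQ : Q ≠ 0)
    (hd : 1 ≤ max P.natDegree Q.natDegree) {a b : ℂ} (hab : a ≠ b) (ha : a ≠ 0) (hb : b ≠ 0)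
    (has : Shares l P Q a) (hbs : Shares l P Q b) :
    P * Q = C l * X * (derivative P * Q - P * derivative Q) := by
  by_contra hne
  have hN : P * Q - C l * X * (derivative P * Q - P * derivative Q) ≠ 0 := sub_ne_zero.2 hne
  obtain ⟨T, hT⟩ := mul_dvd_of_shares hPQ hQ hd hab ha hb has hbs
  have hda := natDegree_le_of_shares hQ ha has
  have hdb := natDegree_le_of_shares hQ hb hbs
  have hA : P - C a * Q ≠ 0 := ne_zero_of_natDegree_gt (hd.trans hda)
  have hB : P - C b * Q ≠ 0 := ne_zero_of_natDegree_gt (hd.trans hdb)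
  have hT0 : T ≠ 0 := by
    rintro rfl
    exact hN (by rw [hT, mul_zero])
  have hNd : (P * Q - C l * X * (derivative P * Q - P * derivative Q)).natDegree
      ≤ P.natDegree + Q.natDegree := by
    rw [mul_assoc (C l)]
    exact natDegree_sub_le_of_both_le natDegree_mul_le
      ((natDegree_C_mul_le _ _).trans (natDegree_X_mul_wronskian_le P Q))
  have hTd : T.natDegree = 0 := by
    rw [hT, natDegree_mul (mul_ne_zero hA hB) hT0, natDegree_mul hA hB] at hNd
    omega
  obtain ⟨k, rfl⟩ := natDegree_eq_zero.1 hTd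
  have hk : k ≠ 0 := by
    rintro rfl
    simp at hT0
  have h1 := mul_sub_eq_one_of_shares hPQ hd ha hk has hT
  have h2 := mul_sub_eq_one_of_shares hPQ hd hb hk hbs
    (by rw [hT, mul_comm (P - C a * Q)])
  have h3 : (2 : ℂ) = 0 := by linear_combination -h1 - h2
  exact two_ne_zero h3

end SharedValues

/-- If a non-constant rational function `R = P/Q` and `∂_z R` share two distinct finite
values on the sphere `ℂ∪{∞}`, then `R ≡ ∂_z R`. -/
theorem R_dzR_share_two_values_on_sphere
    (l : ℂ) (hl : l ≠ 0)
    (P Q : ℂ[X]) (hPQ : IsCoprime P Q) (hQ : Q ≠ 0)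
    (hd : 1 ≤ max P.natDegree Q.natDegree)
    (a b : ℂ) (hab : a ≠ b)
    (hshare : ∀ v ∈ ({a, b} : Set ℂ),
      -- v shared in ℂ*
      (∀ w : ℂ, w ≠ 0 → Q.eval w ≠ 0 →
        (P.eval w = v * Q.eval w ↔
          l * w * (derivative P * Q - P * derivative Q).eval w = v * (Q.eval w) ^ 2)) ∧
      -- v shared at 0
      ((Q.eval 0 ≠ 0 ∧ P.eval 0 = v * Q.eval 0) ↔ (Q.eval 0 ≠ 0 ∧ v = 0)) ∧
      -- v shared at ∞
      ((P - C v * Q).degree < Q.degree ↔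
        (C l * X * (derivative P * Q - P * derivative Q) - C v * Q ^ 2).degree <
          Q.degree + Q.degree)) :
    P * Q = C l * X * (derivative P * Q - P * derivative Q) := by
  have has : SharedValues.Shares l P Q a := hshare a (by simp)
  have hbs : SharedValues.Shares l P Q b := hshare b (by simp)
  by_cases ha : a = 0
  · subst ha
    exact SharedValues.eq_of_shares_zero hl hPQ hQ hd hab.symm has hbs
  by_cases hb : b = 0
  · subst hb
    exact SharedValues.eq_of_shares_zero hl hPQ hQ hd hab hbs has
  exact SharedValues.eq_of_shares_ne_zero hPQ hQ hd hab ha hb has hbs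
end
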